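/- arXiv:math/0207005 — 6 statements merged into one kernel-verified Lean document; each statement's English description precedes it below -/
import Mathlib

section
/- Let A be a unital C*-algebra, let p ∈ A be a projection, and let v_1, …, v_n ∈ A be partial isometries such that v_i* v_i ≤ p for each i and v_1 v_1* + ⋯ + v_n v_n* = 1 − p; set v_0 = p. If S ⊆ A is a subset such that the smallest closed *-subalgebra of A containing S is all of A, then the smallest closed *-subalgebra of A containing the set {v_i* s v_j : s ∈ S, 0 ≤ i, j ≤ n} is exactly the corner pAp = {p a p : a ∈ A}. -/
/-- The elements fixed by compression with a projection `p`, i.e. the corner `pAp`. -/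
def cornerStarSubalgebra {A : Type*} [CStarAlgebra A] (p : A) (hp : IsSelfAdjoint p) :
    NonUnitalStarSubalgebra ℂ A where
  carrier := {x | p * x = x ∧ x * p = x}
  add_mem' := fun ha hb => ⟨by rw [mul_add, ha.1, hb.1], by rw [add_mul, ha.2, hb.2]⟩
  zero_mem' := ⟨mul_zero p, zero_mul p⟩
  mul_mem' := fun ha hb => ⟨by rw [← mul_assoc, ha.1], by rw [mul_assoc, hb.2]⟩
  smul_mem' := fun c _ ha => ⟨by rw [mul_smul_comm, ha.1], by rw [smul_mul_assoc, ha.2]⟩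
  star_mem' := fun {x} ha =>
    ⟨by simpa [hp.star_eq] using congrArg star ha.2, by simpa [hp.star_eq] using congrArg star ha.1⟩

theorem isClosed_cornerStarSubalgebra {A : Type*} [CStarAlgebra A] (p : A)
    (hp : IsSelfAdjoint p) : IsClosed (cornerStarSubalgebra p hp : Set A) :=
  (isClosed_eq (by fun_prop) continuous_id).inter (isClosed_eq (by fun_prop) continuous_id)

/-- If `∑ k, w k * star (w k) = 1`, the elements all of whose matrix entries `star (w i) * a * w j`
lie in a star subalgebra `B` form a star subalgebra. -/
def matrixEntryStarSubalgebra {A ι : Type*} [CStarAlgebra A] [Fintype ι] (w : ι → A)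
    (hw : ∑ k, w k * star (w k) = 1) (B : NonUnitalStarSubalgebra ℂ A) :
    NonUnitalStarSubalgebra ℂ A where
  carrier := {a | ∀ i j, star (w i) * a * w j ∈ B}
  add_mem' := fun ha hb i j => by
    rw [mul_add, add_mul]
    exact add_mem (ha i j) (hb i j)
  zero_mem' := fun i j => by simp
  mul_mem' := fun {a b} ha hb i j => by
    have h : star (w i) * (a * b) * w j =
        ∑ k, (star (w i) * a * w k) * (star (w k) * b * w j) := by
      calc star (w i) * (a * b) * w j
          = star (w i) * a * (∑ k, w k * star (w k)) * (b * w j) := by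
            rw [hw]; simp only [mul_one, mul_assoc]
        _ = _ := by simp only [Finset.mul_sum, Finset.sum_mul, mul_assoc]
    rw [h]
    exact sum_mem fun k _ => mul_mem (ha i k) (hb k j)
  smul_mem' := fun c a ha i j => by
    rw [mul_smul_comm, smul_mul_assoc]
    exact SMulMemClass.smul_mem c (ha i j)
  star_mem' := fun {a} ha i j => by
    simpa [mul_assoc] using star_mem (ha j i)

theorem isClosed_matrixEntryStarSubalgebra {A ι : Type*} [CStarAlgebra A] [Fintype ι] (w : ι → A)
    (hw : ∑ k, w k * star (w k) = 1) (B : NonUnitalStarSubalgebra ℂ A)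
    (hB : IsClosed (B : Set A)) : IsClosed (matrixEntryStarSubalgebra w hw B : Set A) := by
  have h : (matrixEntryStarSubalgebra w hw B : Set A) =
      ⋂ i, ⋂ j, (fun a => star (w i) * a * w j) ⁻¹' (B : Set A) := by
    ext a
    simp only [Set.mem_iInter]
    rfl
  rw [h]
  exact isClosed_iInter fun i => isClosed_iInter fun j => hB.preimage (by fun_prop)


/-- Lemma 2.1(i) of the paper: if `p` is a projection in a unital C*-algebra `A`,
`v 1, …, v n` are partial isometries with `(v i)* (v i) ≤ p` and
`Σ (v i)(v i)* = 1 - p`, and (setting `v 0 = p`) `S` generates `A` as a C*-algebra,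
then `{(v i)* s (v j) : s ∈ S}` generates the corner `pAp` as a C*-algebra. -/
theorem stmt_0 (A : Type*) [CStarAlgebra A] (n : ℕ) (p : A)
    (hp : IsSelfAdjoint p ∧ p * p = p)
    (v : Fin n → A)
    (hpi : ∀ i, v i * star (v i) * v i = v i)
    (hle : ∀ i, star (v i) * v i * p = star (v i) * v i)
    (hsum : ∑ i, v i * star (v i) = 1 - p)
    (S : Set A)
    (hS : (NonUnitalStarAlgebra.adjoin ℂ S).topologicalClosure = ⊤) :
    ((NonUnitalStarAlgebra.adjoin ℂ
        {x : A | ∃ s ∈ S, ∃ i j : Fin (n + 1),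
          x = star ((Fin.cons p v : Fin (n + 1) → A) i) * s * (Fin.cons p v : Fin (n + 1) → A) j}).topologicalClosure : Set A) =
      {x : A | ∃ a : A, x = p * a * p} := by
  obtain ⟨hsa, hidem⟩ := hp
  set w : Fin (n + 1) → A := Fin.cons p v with hw_def
  have hw : ∑ k, w k * star (w k) = 1 := by
    simp [hw_def, Fin.sum_univ_succ, hsum, hsa.star_eq, hidem]
  have hwp : ∀ i, w i * p = w i := by
    refine Fin.cases hidem fun i => ?_
    change v i * p = v i
    calc v i * p = v i * (star (v i) * v i * p) := by rw [← mul_assoc, ← mul_assoc, hpi]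
      _ = v i := by rw [hle, ← mul_assoc, hpi]
  have hpw : ∀ i, p * star (w i) = star (w i) := fun i => by
    simpa [hsa.star_eq] using congrArg star (hwp i)
  apply Set.Subset.antisymm
  · have hgen : (NonUnitalStarAlgebra.adjoin ℂ
        {x : A | ∃ s ∈ S, ∃ i j, x = star (w i) * s * w j}).topologicalClosure ≤
        cornerStarSubalgebra p hsa := by
      refine NonUnitalStarSubalgebra.topologicalClosure_minimal _
        (NonUnitalStarAlgebra.adjoin_le ?_) (isClosed_cornerStarSubalgebra p hsa)
      rintro _ ⟨s, -, i, j, rfl⟩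
      exact ⟨by rw [← mul_assoc, ← mul_assoc, hpw], by rw [mul_assoc, hwp]⟩
    intro x hx
    obtain ⟨h₁, h₂⟩ := hgen hx
    exact ⟨x, by rw [h₁, h₂]⟩
  · rintro _ ⟨a, rfl⟩
    set B := (NonUnitalStarAlgebra.adjoin ℂ
      {x : A | ∃ s ∈ S, ∃ i j, x = star (w i) * s * w j}).topologicalClosure
    have htop : ⊤ ≤ matrixEntryStarSubalgebra w hw B := by
      rw [← hS]
      refine NonUnitalStarSubalgebra.topologicalClosure_minimal _
        (NonUnitalStarAlgebra.adjoin_le fun s hs i j => ?_)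
        (isClosed_matrixEntryStarSubalgebra w hw B
          (NonUnitalStarSubalgebra.isClosed_topologicalClosure _))
      exact NonUnitalStarSubalgebra.le_topologicalClosure _
        (NonUnitalStarAlgebra.subset_adjoin ℂ _ ⟨s, hs, i, j, rfl⟩)
    have h : star p * a * p ∈ B := htop (NonUnitalStarAlgebra.mem_top (x := a)) 0 0
    rwa [hsa.star_eq] at h
end

section
/- Let A be a unital C*-algebra, let p ∈ A be a projection, and let v_1, …, v_n ∈ A be partial isometries such that v_i* v_i ≤ p for each i and v_1 v_1* + ⋯ + v_n v_n* = 1 − p. Then A is residually finite dimensional if and only if the corner pAp = {p a p : a ∈ A} is residually finite dimensional. -/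
/-- A (possibly non-unital) complex *-algebra is residually finite dimensional if its
finite-dimensional *-representations separate points. -/
def IsRFD (B : Type*) [NonUnitalNonAssocSemiring B] [Module ℂ B] [Star B] : Prop :=
  ∀ b : B, b ≠ 0 → ∃ (k : ℕ) (π : B →⋆ₙₐ[ℂ] Matrix (Fin k) (Fin k) ℂ), π b ≠ 0

/-- The corner `pAp = {p a p : a ∈ A}` of a C*-algebra `A`, as a non-unital
*-subalgebra. -/
def corner (A : Type*) [CStarAlgebra A] (p : A) (hp : IsSelfAdjoint p ∧ p * p = p) :
    NonUnitalStarSubalgebra ℂ A where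
  carrier := {x : A | ∃ a : A, x = p * a * p}
  add_mem' := by
    rintro x y ⟨a, rfl⟩ ⟨b, rfl⟩
    exact ⟨a + b, by noncomm_ring⟩
  zero_mem' := ⟨0, by simp⟩
  mul_mem' := by
    rintro x y ⟨a, rfl⟩ ⟨b, rfl⟩
    exact ⟨a * p * p * b, by noncomm_ring⟩
  smul_mem' := by
    rintro c x ⟨a, rfl⟩
    exact ⟨c • a, by simp [mul_smul_comm, smul_mul_assoc]⟩
  star_mem' := by
    rintro x ⟨a, rfl⟩
    exact ⟨star a, by simp [star_mul, hp.1.star_eq, mul_assoc]⟩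

theorem star_mul_mul_mem_corner {A : Type*} [CStarAlgebra A] {p : A}
    {hp : IsSelfAdjoint p ∧ p * p = p} {x y : A} (hx : x * p = x) (hy : y * p = y) (a : A) :
    star x * a * y ∈ corner A p hp := by
  have hpx : p * star x = star x := by
    simpa [hp.1.star_eq] using congrArg star hx
  exact ⟨star x * a * y, by
    rw [mul_assoc p, mul_assoc _ y, hy, ← mul_assoc, ← mul_assoc, hpx]⟩

/-- The *-homomorphism `a ↦ (π ((w i)* a (w j)))`, in block matrix form, attached to a
representation `π` of a corner `pAp` and a finite family `w` with `Σ (w i)(w i)* = 1` and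
`(w i) p = w i`. -/
noncomputable def cornerAmplification {A : Type*} [CStarAlgebra A] {p : A}
    {hp : IsSelfAdjoint p ∧ p * p = p} {ι κ : Type*} [Fintype ι] [Fintype κ] (w : ι → A)
    (hw : ∀ i, w i * p = w i) (hsum : ∑ i, w i * star (w i) = 1)
    (π : corner A p hp →⋆ₙₐ[ℂ] Matrix κ κ ℂ) :
    A →⋆ₙₐ[ℂ] Matrix (ι × κ) (ι × κ) ℂ :=
  let c (i j : ι) (a : A) : corner A p hp :=
    ⟨star (w i) * a * w j, star_mul_mul_mem_corner (hw i) (hw j) a⟩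
  have hmul (i k : ι) (a b : A) : c i k (a * b) = ∑ j, c i j a * c j k b := by
    apply Subtype.ext
    rw [AddSubmonoidClass.coe_finsetSum]
    calc star (w i) * (a * b) * w k
        = star (w i) * a * (∑ j, w j * star (w j)) * b * w k := by
          rw [hsum]; noncomm_ring
      _ = ∑ j, star (w i) * a * w j * (star (w j) * b * w k) := by
          simp only [Finset.mul_sum, Finset.sum_mul, mul_assoc]
  { toFun := fun a => Matrix.of fun x y => π (c x.1 y.1 a) x.2 y.2
    map_smul' := fun r a => by
      ext x y
      have : c x.1 y.1 (r • a) = r • c x.1 y.1 a := Subtype.ext (by simp [c])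
      simp [this]
    map_zero' := by
      ext x y
      have : c x.1 y.1 0 = 0 := Subtype.ext (by simp [c])
      simp [this]
    map_add' := fun a b => by
      ext x y
      have : c x.1 y.1 (a + b) = c x.1 y.1 a + c x.1 y.1 b :=
        Subtype.ext (by simp [c, mul_add, add_mul])
      simp [this]
    map_mul' := fun a b => by
      ext x y
      simp [hmul, Matrix.mul_apply, Matrix.sum_apply, Fintype.sum_prod_type]
    map_star' := fun a => by
      ext x y
      have : c x.1 y.1 (star a) = star (c y.1 x.1 a) :=
        Subtype.ext (by simp [c, mul_assoc])
      simp [this, map_star, Matrix.star_apply] }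

theorem cornerAmplification_apply {A : Type*} [CStarAlgebra A] {p : A}
    {hp : IsSelfAdjoint p ∧ p * p = p} {ι κ : Type*} [Fintype ι] [Fintype κ] (w : ι → A)
    (hw : ∀ i, w i * p = w i) (hsum : ∑ i, w i * star (w i) = 1)
    (π : corner A p hp →⋆ₙₐ[ℂ] Matrix κ κ ℂ) (a : A) (x y : ι × κ)
    (h : star (w x.1) * a * w y.1 ∈ corner A p hp) :
    cornerAmplification w hw hsum π a x y = π ⟨star (w x.1) * a * w y.1, h⟩ x.2 y.2 :=
  rfl

/-- Relabelling the indices of a matrix algebra, as a *-homomorphism. -/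
def matrixReindexStarHom {ι κ : Type*} [Fintype ι] [Fintype κ] (e : κ ≃ ι) :
    Matrix ι ι ℂ →⋆ₙₐ[ℂ] Matrix κ κ ℂ where
  toFun M := M.submatrix e e
  map_smul' _ _ := rfl
  map_zero' := rfl
  map_add' _ _ := rfl
  map_mul' M N := (Matrix.submatrix_mul_equiv M N e e e).symm
  map_star' _ := rfl

theorem matrixReindexStarHom_apply {ι κ : Type*} [Fintype ι] [Fintype κ] (e : κ ≃ ι)
    (M : Matrix ι ι ℂ) : matrixReindexStarHom e M = M.submatrix e e :=
  rfl

theorem exists_star_mul_mul_ne_zero {A ι : Type*} [Semiring A] [Star A] [Fintype ι]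
    {w : ι → A} (hsum : ∑ i, w i * star (w i) = 1) {a : A} (ha : a ≠ 0) :
    ∃ i j, star (w i) * a * w j ≠ 0 := by
  by_contra! h
  apply ha
  calc a = (∑ i, w i * star (w i)) * a * ∑ j, w j * star (w j) := by simp [hsum]
    _ = ∑ i, ∑ j, w i * (star (w i) * a * w j) * star (w j) := by
      simp only [Finset.sum_mul, Finset.mul_sum, mul_assoc]
      exact Finset.sum_comm
    _ = 0 := by simp [h]

theorem IsRFD.of_corner {A : Type*} [CStarAlgebra A] {p : A}
    {hp : IsSelfAdjoint p ∧ p * p = p} {ι : Type*} [Fintype ι] (w : ι → A)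
    (hw : ∀ i, w i * p = w i) (hsum : ∑ i, w i * star (w i) = 1)
    (h : IsRFD (corner A p hp)) : IsRFD A := by
  intro a ha
  obtain ⟨i, j, hij⟩ := exists_star_mul_mul_ne_zero hsum ha
  have hmem : star (w i) * a * w j ∈ corner A p hp :=
    star_mul_mul_mem_corner (hw i) (hw j) a
  obtain ⟨k, π, hπ⟩ := h ⟨_, hmem⟩ fun h0 => hij (congrArg Subtype.val h0)
  let e := (Fintype.equivFin (ι × Fin k)).symm
  refine ⟨_, (matrixReindexStarHom e).comp (cornerAmplification w hw hsum π), fun h0 => hπ ?_⟩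
  ext s t
  rw [← cornerAmplification_apply w hw hsum π a (i, s) (j, t) hmem]
  have := congrFun₂ h0 (e.symm (i, s)) (e.symm (j, t))
  simpa [matrixReindexStarHom_apply] using this

theorem IsRFD.corner {A : Type*} [CStarAlgebra A] {p : A}
    {hp : IsSelfAdjoint p ∧ p * p = p} (h : IsRFD A) : IsRFD (corner A p hp) := by
  intro b hb
  obtain ⟨k, π, hπ⟩ := h b fun h0 => hb (Subtype.ext h0)
  exact ⟨k, π.comp (NonUnitalStarSubalgebraClass.subtype (_root_.corner A p hp)), hπ⟩

/-- Lemma 2.1(ii) of the paper: if `p` is a projection in a unital C*-algebra `A` and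
`v 1, …, v n` are partial isometries with `(v i)* (v i) ≤ p` and `Σ (v i)(v i)* = 1 - p`,
then `A` is residually finite dimensional if and only if the corner `pAp` is. -/
theorem stmt_1 (A : Type*) [CStarAlgebra A] (n : ℕ) (p : A)
    (hp : IsSelfAdjoint p ∧ p * p = p)
    (v : Fin n → A)
    (hpi : ∀ i, v i * star (v i) * v i = v i)
    (hle : ∀ i, star (v i) * v i * p = star (v i) * v i)
    (hsum : ∑ i, v i * star (v i) = 1 - p) :
    IsRFD A ↔ IsRFD (corner A p hp) := by
  refine ⟨IsRFD.corner, IsRFD.of_corner (fun o : Option (Fin n) => o.elim p v) ?_ ?_⟩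
  · rintro (_ | i)
    · exact hp.2
    · calc v i * p = v i * (star (v i) * v i * p) := by
            rw [← mul_assoc, ← mul_assoc, hpi]
        _ = v i := by rw [hle, ← mul_assoc, hpi]
  · simp [Fintype.sum_option, hp.1.star_eq, hp.2, hsum]
end

section
/- Let D be a finite-dimensional C*-algebra, let n, n' be positive integers, and let γ : D → M_n(ℂ) and γ' : D → M_{n'}(ℂ) be unital injective *-homomorphisms such that tr_n ∘ γ = tr_{n'} ∘ γ', where tr_k is the normalized trace on M_k(ℂ). Let H be a complex Hilbert space and let α : M_n(ℂ) → B(H) and β : M_{n'}(ℂ) → B(H) be unital *-homomorphisms with α ∘ γ = β ∘ γ'. Let w_1, …, w_M be finitely many words, each w_i being a finite nonempty list of letters from the disjoint union M_n(ℂ) ⊔ M_{n'}(ℂ); for any pair of unital *-homomorphisms σ : M_n(ℂ) → B(K), ρ : M_{n'}(ℂ) → B(K) on a Hilbert space K, let ev_{σ,ρ}(w_i) ∈ B(K) denote the ordered product obtained by applying σ to each letter from M_n(ℂ) and ρ to each letter from M_{n'}(ℂ). Then for every ε > 0 there exist a finite-dimensional complex Hilbert space K and unital *-homomorphisms α₁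 : M_n(ℂ) → B(K), β₁ : M_{n'}(ℂ) → B(K) satisfying α₁ ∘ γ = β₁ ∘ γ', such that ‖ ev_{α₁,β₁}(w_1) + ⋯ + ev_{α₁,β₁}(w_M) ‖ ≥ ‖ ev_{α,β}(w_1) + ⋯ + ev_{α,β}(w_M) ‖ − ε. -/
/-- Evaluation of a word with letters in `M_n(ℂ) ⊔ M_{n'}(ℂ)` under a pair of
representations `σ`, `ρ`: apply `σ` to each letter from the first summand and `ρ` to each
letter from the second, and take the ordered product. -/
noncomputable def wordEval {X Y B : Type*} [Monoid B] (σ : X → B) (ρ : Y → B)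
    (w : List (X ⊕ Y)) : B :=
  (w.map (Sum.elim σ ρ)).prod

open scoped InnerProductSpace

theorem finite_spectrum_real {A : Type*} [Ring A] [Algebra ℂ A] [FiniteDimensional ℂ A]
    (a : A) : (spectrum ℝ a).Finite := by
  have : Module.Finite ℝ A := Module.Finite.trans ℂ A
  nontriviality A
  have hint : IsIntegral ℝ a := IsIntegral.of_finite ℝ a
  refine ((minpoly ℝ a).rootSet_finite ℝ).subset fun x hx ↦ ?_
  have h := spectrum.subset_polynomial_aeval a (minpoly ℝ a) ⟨x, hx, rfl⟩
  rw [minpoly.aeval, spectrum.zero_eq, Set.mem_singleton_iff] at h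
  exact (Polynomial.mem_rootSet_of_ne (minpoly.ne_zero hint)).2 (by simpa using h)

theorem exists_partialIsometry_of_ne_zero {A : Type*} [CStarAlgebra A] [FiniteDimensional ℂ A]
    {T : A} (hT : T ≠ 0) :
    ∃ g : A, T * g ≠ 0 ∧ (T * g) * star (T * g) * (T * g) = T * g ∧
      ∀ b, Commute (star T * T) b → Commute g b := by
  have hsa : IsSelfAdjoint (star T * T) := .star_mul_self T
  have hcont (f : ℝ → ℝ) : ContinuousOn f (spectrum ℝ (star T * T)) :=
    (finite_spectrum_real _).continuousOn f
  let := CStarAlgebra.spectralOrder A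
  have := CStarAlgebra.spectralOrderedRing A
  have hpos : ∀ x ∈ spectrum ℝ (star T * T), 0 ≤ x :=
    fun x hx ↦ spectrum_nonneg_of_nonneg (star_mul_self_nonneg T) hx
  set f : ℝ → ℝ := fun x ↦ (√x)⁻¹ with hf
  have hmul (f₁ f₂ : ℝ → ℝ) : cfc f₁ (star T * T) * cfc f₂ (star T * T) =
      cfc (fun x ↦ f₁ x * f₂ x) (star T * T) :=
    (cfc_mul f₁ f₂ _ (hcont _) (hcont _)).symm
  have hid : star T * T = cfc (fun x : ℝ ↦ x) (star T * T) := (cfc_id' ℝ _).symm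
  have hstar : star (cfc f (star T * T)) = cfc f (star T * T) := cfc_predicate f (star T * T)
  refine ⟨cfc f (star T * T), fun h0 ↦ hT ?_, ?_, fun b hb ↦ hb.cfc_real f⟩
  · have h1 : star T * (T * cfc f (star T * T)) * cfc Real.sqrt (star T * T) = star T * T := by
      rw [← mul_assoc]
      nth_rw 1 [hid]
      nth_rw 4 [hid]
      rw [hmul, hmul]
      refine cfc_congr fun x hx ↦ ?_
      rcases (hpos x hx).eq_or_lt with rfl | hx0
      · simp
      · have : √x ≠ 0 := (Real.sqrt_pos.2 hx0).ne'
        simp only [hf]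
        field_simp
    rw [h0] at h1
    simpa using h1.symm
  · rw [star_mul, hstar]
    have h2 : cfc f (star T * T) * (cfc f (star T * T) * (star T * T) * cfc f (star T * T)) =
        cfc f (star T * T) := by
      nth_rw 3 [hid]
      rw [hmul, hmul, hmul]
      refine cfc_congr fun x hx ↦ ?_
      rcases (hpos x hx).eq_or_lt with rfl | hx0
      · simp [hf]
      · have h3 : √x ≠ 0 := (Real.sqrt_pos.2 hx0).ne'
        have h4 : x = √x * √x := (Real.mul_self_sqrt hx0.le).symm
        simp only [hf]
        field_simp
        rw [sq, ← h4]
    calc _ = T * (cfc f (star T * T) * (cfc f (star T * T) * (star T * T) * cfc f (star T * T))) := by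
          simp only [mul_assoc]
      _ = _ := by rw [h2]

theorem exists_casimir {n : ℕ} {D : Type*} [CStarAlgebra D]
    (γ : D →⋆ₐ[ℂ] Matrix (Fin n) (Fin n) ℂ) (hγ : Function.Injective γ) :
    ∃ (m : ℕ) (e : Fin m → D) (c : D → Fin m → Fin m → ℂ),
      (∀ d j, d * e j = ∑ i, c d i j • e i) ∧
      (∀ d i, star (e i) * d = ∑ j, c d i j • star (e j)) ∧
      ∀ d, ∃ x : Fin m → ℂ, d = ∑ i, x i • e i := by
  let L : D →ₗ[ℂ] EuclideanSpace ℂ (Fin n × Fin n) :=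
    { toFun := fun d ↦ WithLp.toLp 2 fun p ↦ γ d p.1 p.2
      map_add' := fun x y ↦ by ext p; simp
      map_smul' := fun r x ↦ by ext p; simp }
  have hL : Function.Injective L := by
    intro x y h
    apply hγ
    ext i j
    exact congrArg (fun v : EuclideanSpace ℂ (Fin n × Fin n) ↦ v (i, j)) h
  have hinner (d x y : D) : ⟪L x, L (d * y)⟫_ℂ = ⟪L (star d * x), L y⟫_ℂ := by
    have key (x y : D) : ⟪L x, L y⟫_ℂ = ((γ (star x)) * γ y).trace := by
      simp only [L, LinearMap.coe_mk, AddHom.coe_mk, PiLp.inner_apply, Fintype.sum_prod_type,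
        map_star, Matrix.trace, Matrix.diag, Matrix.mul_apply, Matrix.star_apply]
      rw [Finset.sum_comm]
      simp [mul_comm]
    rw [key, key]
    simp only [star_mul, star_star, map_mul, mul_assoc]
  let b := stdOrthonormalBasis ℂ (LinearMap.range L)
  let E := LinearEquiv.ofInjective L hL
  have hE (v : LinearMap.range L) : L (E.symm v) = v :=
    congrArg Subtype.val (E.apply_symm_apply v)
  have hexp (d : D) : d = ∑ i, ⟪L (E.symm (b i)), L d⟫_ℂ • E.symm (b i) := by
    apply hL
    have h := congrArg Subtype.val (b.sum_repr' (E d)).symm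
    rw [map_sum]
    simp only [map_smul, hE]
    have hEd : (E d : EuclideanSpace ℂ (Fin n × Fin n)) = L d := rfl
    simpa [hEd] using h
  refine ⟨_, fun i ↦ E.symm (b i),
    fun d i j ↦ ⟪L (E.symm (b i)), L (d * E.symm (b j))⟫_ℂ, fun d j ↦ hexp _, fun d i ↦ ?_,
    fun d ↦ ⟨_, hexp d⟩⟩
  have h := congrArg star (hexp (star d * E.symm (b i)))
  simp only [star_mul, star_star, star_sum, star_smul] at h
  rw [h]
  refine Finset.sum_congr rfl fun j _ ↦ ?_
  rw [hinner, star_star]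
  exact congrArg (· • _) (inner_conj_symm _ _)

section OpTrace

/-- The (unnormalized) trace on the bounded operators of a finite-dimensional Hilbert space. -/
noncomputable def opTrace (K : Type*) [NormedAddCommGroup K] [InnerProductSpace ℂ K] :
    (K →L[ℂ] K) →ₗ[ℂ] ℂ :=
  (LinearMap.trace ℂ K) ∘ₗ (ContinuousLinearMap.coeLM ℂ)

variable {K : Type*} [NormedAddCommGroup K] [InnerProductSpace ℂ K]

theorem opTrace_eq_sum {ι : Type*} [Fintype ι] (b : OrthonormalBasis ι ℂ K) (T : K →L[ℂ] K) :
    opTrace K T = ∑ i, ⟪b i, T (b i)⟫_ℂ :=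
  LinearMap.trace_eq_sum_inner _ b

theorem opTrace_mul_comm (S T : K →L[ℂ] K) : opTrace K (S * T) = opTrace K (T * S) :=
  LinearMap.trace_mul_comm ℂ (S : K →ₗ[ℂ] K) T

variable [FiniteDimensional ℂ K]

theorem opTrace_one : opTrace K 1 = Module.finrank ℂ K :=
  LinearMap.trace_one ℂ K

theorem opTrace_star (T : K →L[ℂ] K) : opTrace K (star T) = star (opTrace K T) := by
  rw [opTrace_eq_sum (stdOrthonormalBasis ℂ K), opTrace_eq_sum (stdOrthonormalBasis ℂ K), star_sum]
  refine Finset.sum_congr rfl fun i _ ↦ ?_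
  rw [ContinuousLinearMap.star_eq_adjoint, ContinuousLinearMap.adjoint_inner_right]
  exact (inner_conj_symm _ _).symm

theorem eq_zero_of_opTrace_star_mul_self {T : K →L[ℂ] K} (h : opTrace K (star T * T) = 0) :
    T = 0 := by
  let b := stdOrthonormalBasis ℂ K
  have h1 : ((∑ i, ‖T (b i)‖ ^ 2 : ℝ) : ℂ) = 0 := by
    rw [← h, opTrace_eq_sum b, Complex.ofReal_sum]
    refine Finset.sum_congr rfl fun i _ ↦ ?_
    rw [mul_apply_eq_comp, ContinuousLinearMap.star_eq_adjoint,
      ContinuousLinearMap.adjoint_inner_right, inner_self_eq_norm_sq_to_K]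
    simp
  rw [Complex.ofReal_eq_zero, Finset.sum_eq_zero_iff_of_nonneg fun _ _ ↦ by positivity] at h1
  refine ContinuousLinearMap.coe_injective (b.toBasis.ext fun i ↦ ?_)
  simpa using h1 i (Finset.mem_univ i)

theorem sum_opTrace_mul_opTrace_eq_zero {ι : Type*} [Fintype ι] {A B : ι → K →L[ℂ] K}
    (h : ∀ S : K →L[ℂ] K, ∑ i, A i * S * B i = 0) :
    ∑ i, opTrace K (A i) * opTrace K (B i) = 0 := by
  let b := stdOrthonormalBasis ℂ K
  simp only [opTrace_eq_sum b, Finset.sum_mul_sum]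
  rw [Finset.sum_comm]
  refine Finset.sum_eq_zero fun k _ ↦ ?_
  rw [Finset.sum_comm]
  refine Finset.sum_eq_zero fun l _ ↦ ?_
  have h1 := congrArg (fun T : K →L[ℂ] K ↦ ⟪b k, T (b l)⟫_ℂ)
    (h (InnerProductSpace.rankOne ℂ (b k) (b l)))
  simpa [sum_apply, inner_sum, inner_smul_right, mul_comm] using h1

theorem exists_ne_zero_intertwiner {n : ℕ} {D : Type*} [CStarAlgebra D]
    (γ : D →⋆ₐ[ℂ] Matrix (Fin n) (Fin n) ℂ) (hγ : Function.Injective γ)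
    (π ρ : D →⋆ₐ[ℂ] (K →L[ℂ] K)) {p q : K →L[ℂ] K} (hq : IsSelfAdjoint q) (hq' : q * q = q)
    (hp : IsSelfAdjoint p) (hp' : p * p = p)
    (hqπ : ∀ d, Commute (π d) q) (hpρ : ∀ d, Commute (ρ d) p)
    (htr : ∀ d, opTrace K (π d * q) = opTrace K (ρ d * p)) (hq0 : q ≠ 0) :
    ∃ T : K →L[ℂ] K, T ≠ 0 ∧ q * T = T ∧ T * p = T ∧ ∀ d, π d * T = T * ρ d := by
  obtain ⟨m, e, c, hc₁, hc₂, hspan⟩ := exists_casimir γ hγ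
  by_contra! hcon
  have hzero (S : K →L[ℂ] K) : ∑ i, (π (e i) * q) * S * (ρ (star (e i)) * p) = 0 := by
    by_contra hne
    obtain ⟨d, hd⟩ := hcon _ hne
      (by
        rw [Finset.mul_sum]
        refine Finset.sum_congr rfl fun i _ ↦ ?_
        rw [(hqπ (e i)).eq]
        simp only [← mul_assoc, hq'])
      (by
        rw [Finset.sum_mul]
        refine Finset.sum_congr rfl fun i _ ↦ ?_
        simp only [mul_assoc, hp'])
    refine hd ?_
    have h1 (i : Fin m) : π d * (π (e i) * q * S * (ρ (star (e i)) * p)) =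
        ∑ j, c d j i • (π (e j) * q * S * (ρ (star (e i)) * p)) := by
      simp only [← mul_assoc, ← map_mul, hc₁, map_sum, map_smul, Finset.sum_mul, smul_mul_assoc]
    have h2 (i : Fin m) : π (e i) * q * S * (ρ (star (e i)) * p) * ρ d =
        ∑ j, c d i j • (π (e i) * q * S * (ρ (star (e j)) * p)) := by
      rw [mul_assoc _ _ (ρ d), mul_assoc _ p, ← (hpρ d).eq, ← mul_assoc _ (ρ d), ← map_mul, hc₂]
      simp only [map_sum, map_smul, Finset.sum_mul, Finset.mul_sum, smul_mul_assoc,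
        mul_smul_comm]
    simp only [Finset.mul_sum, Finset.sum_mul, h1, h2]
    rw [Finset.sum_comm]
  have hsum := sum_opTrace_mul_opTrace_eq_zero hzero
  have hconj (d : D) : opTrace K (ρ (star d) * p) = star (opTrace K (π d * q)) := by
    rw [htr, ← opTrace_star, star_mul, hp.star_eq, ← map_star, (hpρ _).eq]
  simp only [hconj, Complex.star_def, Complex.mul_conj] at hsum
  rw [← Complex.ofReal_sum, Complex.ofReal_eq_zero,
    Finset.sum_eq_zero_iff_of_nonneg fun _ _ ↦ Complex.normSq_nonneg _] at hsum
  obtain ⟨x, hx⟩ := hspan 1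
  refine hq0 (eq_zero_of_opTrace_star_mul_self ?_)
  rw [hq.star_eq, hq', ← one_mul q, ← map_one π, hx]
  simp only [map_sum, map_smul, Finset.sum_mul, smul_mul_assoc]
  refine Finset.sum_eq_zero fun i hi ↦ ?_
  rw [Complex.normSq_eq_zero.1 (hsum i hi), smul_zero]

theorem exists_unitary_intertwiner {n : ℕ} {D : Type*} [CStarAlgebra D]
    (γ : D →⋆ₐ[ℂ] Matrix (Fin n) (Fin n) ℂ) (hγ : Function.Injective γ)
    (π ρ : D →⋆ₐ[ℂ] (K →L[ℂ] K)) (htr : ∀ d, opTrace K (π d) = opTrace K (ρ d))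
    (W : K →L[ℂ] K) (hW : W * star W * W = W) (hint : ∀ d, π d * W = W * ρ d) :
    ∃ U : K →L[ℂ] K, U ∈ unitary (K →L[ℂ] K) ∧ (∀ d, π d * U = U * ρ d) ∧
      U * (star W * W) = W := by
  induction hm : Module.finrank ℂ K - Module.finrank ℂ (LinearMap.range (W : K →ₗ[ℂ] K))
    using Nat.strong_induction_on generalizing W with
  | _ m ih =>
  have hint' (d : D) : star W * π d = ρ d * star W := by
    have := congrArg star (hint (star d))
    simpa [star_mul, map_star] using this
  have hW' : star W * W * star W = star W := by
    have := congrArg star hW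
    simpa [star_mul, mul_assoc] using this
  set q : K →L[ℂ] K := 1 - W * star W with hq
  set p : K →L[ℂ] K := 1 - star W * W with hp
  by_cases hq0 : q = 0
  · have h1 : W * star W = 1 := (sub_eq_zero.1 hq0).symm
    have h2 : star W * W = 1 := by
      have h3 := mul_eq_one_comm.1
        (congrArg (fun T : K →L[ℂ] K ↦ (T : Module.End ℂ K)) h1)
      exact ContinuousLinearMap.coe_injective h3
    exact ⟨W, Unitary.mem_iff.2 ⟨h2, h1⟩, hint, by rw [h2, mul_one]⟩
  have hqW : q * W = 0 := by rw [hq, sub_mul, one_mul, hW, sub_self]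
  have hWp : W * p = 0 := by rw [hp, mul_sub, mul_one, ← mul_assoc, hW, sub_self]
  have hpW : p * star W = 0 := by rw [hp, sub_mul, one_mul, hW', sub_self]
  obtain ⟨T, hT0, hqT, hTp, hT⟩ := exists_ne_zero_intertwiner γ hγ π ρ (p := p) (q := q)
    (by rw [hq]; exact .sub (.one _) (.mul_star_self W))
    (by
      have : q * q = q - q * W * star W := by nth_rw 2 [hq]; rw [mul_sub, mul_one, mul_assoc]
      rw [this, hqW, zero_mul, sub_zero])
    (by rw [hp]; exact .sub (.one _) (.star_mul_self W))
    (by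
      have : p * p = p - p * star W * W := by nth_rw 2 [hp]; rw [mul_sub, mul_one, mul_assoc]
      rw [this, hpW, zero_mul, sub_zero])
    (fun d ↦ .sub_right (.one_right _) <| by
      rw [commute_iff_eq, ← mul_assoc, hint, mul_assoc, mul_assoc, hint'])
    (fun d ↦ .sub_right (.one_right _) <| by
      rw [commute_iff_eq, ← mul_assoc, ← hint', mul_assoc, mul_assoc, hint])
    (fun d ↦ by
      rw [hq, hp, mul_sub, mul_sub, mul_one, mul_one, map_sub, map_sub, htr, ← mul_assoc, hint,
        mul_assoc, opTrace_mul_comm, mul_assoc])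
    hq0
  obtain ⟨g, hTg0, hTg, hg⟩ := exists_partialIsometry_of_ne_zero hT0
  have hT' (d : D) : star T * π d = ρ d * star T := by
    have := congrArg star (hT (star d))
    simpa [star_mul, map_star] using this
  have hgρ (d : D) : Commute g (ρ d) := hg _ <| by
    rw [commute_iff_eq, mul_assoc, ← hT, ← mul_assoc, hT', mul_assoc]
  have hgp : Commute g p := hg _ <| by
    have h1 : p * star T = star T := by
      have := congrArg star hTp
      rwa [star_mul, hp, star_sub, star_one, star_mul, star_star, ← hp] at this
    rw [commute_iff_eq, mul_assoc, hTp, ← mul_assoc, h1]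
  set V := T * g with hV
  have hqV : q * V = V := by rw [hV, ← mul_assoc, hqT]
  have hVp : V * p = V := by rw [hV, mul_assoc, hgp.eq, ← mul_assoc, hTp]
  have hWV : star W * V = 0 := by
    have h0 : star W * q = 0 := by rw [hq, mul_sub, mul_one, ← mul_assoc, hW', sub_self]
    rw [← hqV, ← mul_assoc, h0, zero_mul]
  have hVW : V * star W = 0 := by rw [← hVp, mul_assoc, hpW, mul_zero]
  have hVW' : star V * W = 0 := by simpa using congrArg star hWV
  have hWV' : W * star V = 0 := by simpa using congrArg star hVW
  have hmul : star (W + V) * (W + V) = star W * W + star V * V := by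
    rw [star_add, add_mul, mul_add, mul_add, hWV, hVW', add_zero, zero_add]
  have hmul' : (W + V) * (star W * W) = W := by
    rw [add_mul, ← mul_assoc, hW, ← mul_assoc, hVW, zero_mul, add_zero]
  have hpart : (W + V) * star (W + V) * (W + V) = W + V := by
    rw [mul_assoc, hmul, mul_add, hmul', add_mul, ← mul_assoc, hWV', zero_mul, zero_add,
      ← mul_assoc, hTg]
  have hlt : Module.finrank ℂ (LinearMap.range (W : K →ₗ[ℂ] K)) <
      Module.finrank ℂ (LinearMap.range ((W + V : K →L[ℂ] K) : K →ₗ[ℂ] K)) := by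
    refine Submodule.finrank_lt_finrank_of_lt (lt_of_le_not_ge ?_ fun hle ↦ hTg0 ?_)
    · rintro _ ⟨x, rfl⟩
      exact ⟨(star W * W) x, congrArg (fun T : K →L[ℂ] K ↦ T x) hmul'⟩
    · ext x
      obtain ⟨y, hy⟩ := hle ⟨x, rfl⟩
      have h1 : q (W y) = 0 := congrArg (fun T : K →L[ℂ] K ↦ T y) hqW
      have h2 : q (V x) = V x := congrArg (fun T : K →L[ℂ] K ↦ T x) hqV
      have h3 : q (W x) = 0 := congrArg (fun T : K →L[ℂ] K ↦ T x) hqW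
      have h4 : W y = W x + V x := hy
      rw [h4, map_add, h3, zero_add, h2] at h1
      exact h1
  have hle := Submodule.finrank_le (LinearMap.range ((W + V : K →L[ℂ] K) : K →ₗ[ℂ] K))
  obtain ⟨U, hU, hUint, hUW⟩ := ih _ (by omega) (W + V) hpart
    (fun d ↦ by rw [mul_add, add_mul, hint, hV, ← mul_assoc, hT, mul_assoc, mul_assoc,
      (hgρ d).eq]) rfl
  refine ⟨U, hU, hUint, ?_⟩
  have h5 : (star W * W) = star (W + V) * (W + V) * (star W * W) := by
    rw [mul_assoc, hmul', star_add, add_mul, hVW', add_zero]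
  rw [h5, ← mul_assoc, hUW, hmul']

end OpTrace

theorem opTrace_starAlgHom_matrix {n : ℕ} (hn : 0 < n) {K : Type*} [NormedAddCommGroup K]
    [InnerProductSpace ℂ K] [FiniteDimensional ℂ K]
    (f : Matrix (Fin n) (Fin n) ℂ →⋆ₐ[ℂ] (K →L[ℂ] K)) (x : Matrix (Fin n) (Fin n) ℂ) :
    opTrace K (f x) = Module.finrank ℂ K * (x.trace / n) := by
  have hcomm (x y : Matrix (Fin n) (Fin n) ℂ) : opTrace K (f (x * y)) = opTrace K (f (y * x)) := by
    rw [map_mul f, map_mul f, opTrace_mul_comm]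
  have hoff (i j : Fin n) (hij : i ≠ j) (c : ℂ) : opTrace K (f (Matrix.single i j c)) = 0 := by
    have h := hcomm (Matrix.single i i 1) (Matrix.single i j c)
    rwa [Matrix.single_mul_single_same, one_mul, Matrix.single_mul_single_of_ne _ _ _ _ hij.symm,
      map_zero, map_zero] at h
  have hdiag (i : Fin n) (c : ℂ) : opTrace K (f (Matrix.single i i c)) =
      c * opTrace K (f (Matrix.single ⟨0, hn⟩ ⟨0, hn⟩ 1)) := by
    have h := hcomm (Matrix.single i ⟨0, hn⟩ c) (Matrix.single ⟨0, hn⟩ i 1)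
    rw [Matrix.single_mul_single_same, Matrix.single_mul_single_same, mul_one, one_mul] at h
    rw [h, ← smul_eq_mul, ← map_smul, ← map_smul, Matrix.smul_single, smul_eq_mul, mul_one]
  have hx (x : Matrix (Fin n) (Fin n) ℂ) :
      opTrace K (f x) = x.trace * opTrace K (f (Matrix.single ⟨0, hn⟩ ⟨0, hn⟩ 1)) := by
    nth_rw 1 [Matrix.matrix_eq_sum_single x]
    simp only [map_sum, Matrix.trace, Finset.sum_mul, Matrix.diag]
    refine Finset.sum_congr rfl fun i _ ↦ ?_
    rw [Finset.sum_eq_single i (fun j _ hj ↦ hoff i j hj.symm _) (by simp), hdiag]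
  have h1 := hx 1
  rw [map_one, opTrace_one, Matrix.trace_one, Fintype.card_fin] at h1
  have hn' : (n : ℂ) ≠ 0 := Nat.cast_ne_zero.2 hn.ne'
  rw [hx x, h1]
  field_simp

section Amplification

variable {A : Type*} [Ring A] [StarRing A] [Algebra ℂ A]
  {H : Type*} [NormedAddCommGroup H] [InnerProductSpace ℂ H] [CompleteSpace H]

/-- The direct sum of `k` copies of the restriction of a representation to an invariant
finite-dimensional subspace. -/
noncomputable def amplification (α : A →⋆ₐ[ℂ] (H →L[ℂ] H)) (E : Submodule ℂ H)
    [FiniteDimensional ℂ E] (hE : ∀ a, ∀ v ∈ E, α a v ∈ E) (k : ℕ) :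
    A →⋆ₐ[ℂ] (PiLp 2 (fun _ : Fin k ↦ E) →L[ℂ] PiLp 2 (fun _ : Fin k ↦ E)) where
  toFun a := LinearMap.toContinuousLinearMap
    { toFun := fun x ↦ WithLp.toLp 2 fun i ↦ ⟨α a (x i), hE a _ (x i).2⟩
      map_add' := fun x y ↦ by ext i; simp
      map_smul' := fun c x ↦ by ext i; simp }
  map_one' := by ext x i; simp
  map_mul' a b := by ext x i; simp
  map_zero' := by ext x i; simp
  map_add' a b := by ext x i; simp
  commutes' c := by ext x i; simp [Algebra.algebraMap_eq_smul_one]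
  map_star' a := by
    rw [ContinuousLinearMap.star_eq_adjoint, ContinuousLinearMap.eq_adjoint_iff]
    intro x y
    simp only [LinearMap.coe_toContinuousLinearMap', LinearMap.coe_mk, AddHom.coe_mk,
      PiLp.inner_apply]
    refine Finset.sum_congr rfl fun i _ ↦ ?_
    simp only [Submodule.coe_inner, map_star, ContinuousLinearMap.star_eq_adjoint,
      ContinuousLinearMap.adjoint_inner_left]

theorem exists_amplification (α : A →⋆ₐ[ℂ] (H →L[ℂ] H)) (E : Submodule ℂ H)
    [FiniteDimensional ℂ E] (hE : ∀ a, ∀ v ∈ E, α a v ∈ E) {k d : ℕ} (hk : 0 < k)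
    (hd : k * Module.finrank ℂ E = d) :
    ∃ (α₀ : A →⋆ₐ[ℂ] (EuclideanSpace ℂ (Fin d) →L[ℂ] EuclideanSpace ℂ (Fin d)))
      (J : E →ₗᵢ[ℂ] EuclideanSpace ℂ (Fin d)),
      ∀ a (v : E), α₀ a (J v) = J ⟨α a v, hE a v v.2⟩ := by
  have hfin : Module.finrank ℂ (PiLp 2 (fun _ : Fin k ↦ E)) = d := by
    rw [(WithLp.linearEquiv 2 ℂ (Fin k → E)).finrank_eq, Module.finrank_pi_fintype]
    simpa using hd
  let e : PiLp 2 (fun _ : Fin k ↦ E) ≃ₗᵢ[ℂ] EuclideanSpace ℂ (Fin d) :=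
    ((stdOrthonormalBasis ℂ (PiLp 2 (fun _ : Fin k ↦ E))).reindex (finCongr hfin)).repr
  let J₀ : E →ₗᵢ[ℂ] PiLp 2 (fun _ : Fin k ↦ E) :=
    { toFun := fun v ↦ PiLp.single 2 ⟨0, hk⟩ v
      map_add' := fun v w ↦ PiLp.single_add 2 _
      map_smul' := fun c v ↦ by
        rw [← PiLp.toLp_single, ← PiLp.toLp_single, Pi.single_smul, WithLp.toLp_smul,
          RingHom.id_apply]
      norm_map' := fun v ↦ PiLp.norm_single 2 (fun _ : Fin k ↦ E) _ _ }
  refine ⟨e.conjStarAlgEquiv.toStarAlgHom.comp (amplification α E hE k),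
    e.toLinearIsometry.comp J₀, fun a v ↦ ?_⟩
  have h : amplification α E hE k a (J₀ v) = J₀ ⟨α a v, hE a v v.2⟩ := by
    ext i
    by_cases hi : i = ⟨0, hk⟩
    · subst hi
      simp [amplification, J₀]
    · simp [amplification, J₀, hi]
  change e (amplification α E hE k a (e.symm (e (J₀ v)))) = e (J₀ _)
  rw [e.symm_apply_apply, h]

theorem exists_invariant_submodule [FiniteDimensional ℂ A] (α : A →⋆ₐ[ℂ] (H →L[ℂ] H))
    (V : Submodule ℂ H) [FiniteDimensional ℂ V] :
    ∃ E : Submodule ℂ H, FiniteDimensional ℂ E ∧ V ≤ E ∧ ∀ a, ∀ v ∈ E, α a v ∈ E := by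
  let B : A →ₗ[ℂ] H →ₗ[ℂ] H :=
    (ContinuousLinearMap.coeLM ℂ) ∘ₗ (α : A →ₐ[ℂ] (H →L[ℂ] H)).toLinearMap
  have hB (a : A) (v : H) : B a v = α a v := rfl
  refine ⟨Submodule.map₂ B ⊤ V, ?_, fun v hv ↦ ?_, fun a v hv ↦ ?_⟩
  · exact Module.Finite.iff_fg.2 (Submodule.FG.map₂ B Module.Finite.fg_top
      (Module.Finite.iff_fg.1 inferInstance))
  · simpa [hB] using Submodule.apply_mem_map₂ B (Submodule.mem_top (x := 1)) hv
  · have hle : Submodule.map₂ B ⊤ V ≤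
        (Submodule.map₂ B ⊤ V).comap (α a : H →ₗ[ℂ] H) := by
      refine Submodule.map₂_le.2 fun b _ w hw ↦ ?_
      have := Submodule.apply_mem_map₂ B (Submodule.mem_top (x := a * b)) hw
      simpa [hB] using this
    exact hle hv

end Amplification

theorem exists_finiteDimensional_pair {n n' : ℕ} (hn : 0 < n) (hn' : 0 < n')
    {D : Type*} [CStarAlgebra D]
    (γ : D →⋆ₐ[ℂ] Matrix (Fin n) (Fin n) ℂ) (γ' : D →⋆ₐ[ℂ] Matrix (Fin n') (Fin n') ℂ)
    (hγ : Function.Injective γ)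
    (htr : ∀ d : D, (γ d).trace / (n : ℂ) = (γ' d).trace / (n' : ℂ))
    {H : Type*} [NormedAddCommGroup H] [InnerProductSpace ℂ H] [CompleteSpace H]
    (α : Matrix (Fin n) (Fin n) ℂ →⋆ₐ[ℂ] (H →L[ℂ] H))
    (β : Matrix (Fin n') (Fin n') ℂ →⋆ₐ[ℂ] (H →L[ℂ] H))
    (hαβ : α.comp γ = β.comp γ') (V : Submodule ℂ H) [FiniteDimensional ℂ V] [Nontrivial V]
    (hV : ∀ d, ∀ v ∈ V, α (γ d) v ∈ V) :
    ∃ (N : ℕ)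
      (α₁ : Matrix (Fin n) (Fin n) ℂ →⋆ₐ[ℂ]
        (EuclideanSpace ℂ (Fin N) →L[ℂ] EuclideanSpace ℂ (Fin N)))
      (β₁ : Matrix (Fin n') (Fin n') ℂ →⋆ₐ[ℂ]
        (EuclideanSpace ℂ (Fin N) →L[ℂ] EuclideanSpace ℂ (Fin N)))
      (J : V →ₗᵢ[ℂ] EuclideanSpace ℂ (Fin N)),
      α₁.comp γ = β₁.comp γ' ∧
      (∀ x (v v' : V), (v' : H) = α x v → α₁ x (J v) = J v') ∧
      (∀ y (v v' : V), (v' : H) = β y v → β₁ y (J v) = J v') := by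
  have hαβ' (d : D) : α (γ d) = β (γ' d) := DFunLike.congr_fun hαβ d
  obtain ⟨E, hEfin, hVE, hE⟩ := exists_invariant_submodule α V
  obtain ⟨F, hFfin, hVF, hF⟩ := exists_invariant_submodule β V
  have : Nontrivial E := (Submodule.inclusion_injective hVE).nontrivial
  have : Nontrivial F := (Submodule.inclusion_injective hVF).nontrivial
  obtain ⟨N, hN⟩ : ∃ N, N = Module.finrank ℂ F * Module.finrank ℂ E := ⟨_, rfl⟩
  obtain ⟨α₀, J₀', hJ₀'⟩ := exists_amplification α E hE
    (Module.finrank_pos (R := ℂ) (M := F)) hN.symm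
  obtain ⟨β₀, J₁', hJ₁'⟩ := exists_amplification β F hF
    (Module.finrank_pos (R := ℂ) (M := E)) ((mul_comm _ _).trans hN.symm)
  let J₀ : V →ₗᵢ[ℂ] EuclideanSpace ℂ (Fin N) :=
    J₀'.comp ⟨Submodule.inclusion hVE, fun _ ↦ rfl⟩
  let J₁ : V →ₗᵢ[ℂ] EuclideanSpace ℂ (Fin N) :=
    J₁'.comp ⟨Submodule.inclusion hVF, fun _ ↦ rfl⟩
  have hJ₀ (x) (v v' : V) (h : (v' : H) = α x v) : α₀ x (J₀ v) = J₀ v' :=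
    (hJ₀' x (Submodule.inclusion hVE v)).trans (congrArg J₀' (Subtype.ext h.symm))
  have hJ₁ (y) (v v' : V) (h : (v' : H) = β y v) : β₀ y (J₁ v) = J₁ v' :=
    (hJ₁' y (Submodule.inclusion hVF v)).trans (congrArg J₁' (Subtype.ext h.symm))
  let P₀ := ContinuousLinearMap.adjoint J₀.toContinuousLinearMap
  let P₁ := ContinuousLinearMap.adjoint J₁.toContinuousLinearMap
  have hP₀ (v : V) : P₀ (J₀ v) = v := by
    refine ext_inner_left ℂ fun u ↦ ?_
    rw [ContinuousLinearMap.adjoint_inner_right]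
    exact J₀.inner_map_map u v
  have hP₁ (v : V) : P₁ (J₁ v) = v := by
    refine ext_inner_left ℂ fun u ↦ ?_
    rw [ContinuousLinearMap.adjoint_inner_right]
    exact J₁.inner_map_map u v
  let W : EuclideanSpace ℂ (Fin N) →L[ℂ] EuclideanSpace ℂ (Fin N) :=
    J₀.toContinuousLinearMap ∘L P₁
  have hWstar : star W = J₁.toContinuousLinearMap ∘L P₀ := by
    rw [ContinuousLinearMap.star_eq_adjoint, ContinuousLinearMap.adjoint_comp,
      ContinuousLinearMap.adjoint_adjoint]
  have hW (z) : W z = J₀ (P₁ z) := rfl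
  have hWs (z) : star W z = J₁ (P₀ z) := by rw [hWstar]; rfl
  have hintW (d : D) : α₀ (γ d) * W = W * β₀ (γ' d) := by
    ext1 z
    simp only [mul_apply_eq_comp, hW]
    rw [hJ₀ (γ d) (P₁ z) ⟨α (γ d) (P₁ z), hV d _ (P₁ z).2⟩ rfl]
    congr 1
    refine ext_inner_left ℂ fun u ↦ ?_
    rw [ContinuousLinearMap.adjoint_inner_right]
    change _ = ⟪J₁ u, _⟫_ℂ
    rw [← ContinuousLinearMap.adjoint_inner_left, ← ContinuousLinearMap.star_eq_adjoint,
      ← map_star, ← map_star, hJ₁ _ u ⟨α (γ (star d)) u, hV _ _ u.2⟩ 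
        (congrArg (fun T : H →L[ℂ] H ↦ T u) (hαβ' _))]
    change _ = ⟪J₁.toContinuousLinearMap _, z⟫_ℂ
    rw [← ContinuousLinearMap.adjoint_inner_right, Submodule.coe_inner, Submodule.coe_inner]
    simp only [map_star, ContinuousLinearMap.star_eq_adjoint,
      ContinuousLinearMap.adjoint_inner_left]
    rfl
  obtain ⟨U, hU, hint, hUW⟩ := exists_unitary_intertwiner γ hγ (α₀.comp γ) (β₀.comp γ')
    (fun d ↦ by
      rw [StarAlgHom.comp_apply, StarAlgHom.comp_apply, opTrace_starAlgHom_matrix hn,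
        opTrace_starAlgHom_matrix hn', htr])
    W (by ext1 z; simp only [mul_apply_eq_comp, hW, hWs, hP₀, hP₁])
    hintW
  have hUJ (v : V) : U (J₁ v) = J₀ v := by
    have h := congrArg
      (fun T : EuclideanSpace ℂ (Fin N) →L[ℂ] EuclideanSpace ℂ (Fin N) ↦ T (J₁ v)) hUW
    simpa only [mul_apply_eq_comp, hW, hWs, hP₀, hP₁] using h
  have hUU (z) : U (star U z) = z :=
    congrArg (fun T : EuclideanSpace ℂ (Fin N) →L[ℂ] EuclideanSpace ℂ (Fin N) ↦ T z)
      (Unitary.mem_iff.1 hU).2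
  have hUJ' (v : V) : star U (J₀ v) = J₁ v := by
    rw [← hUJ]
    exact congrArg (fun T : EuclideanSpace ℂ (Fin N) →L[ℂ] EuclideanSpace ℂ (Fin N) ↦ T (J₁ v))
      (Unitary.mem_iff.1 hU).1
  let β₁ := (Unitary.conjStarAlgAut ℂ _ (⟨U, hU⟩ : unitary _)).toStarAlgHom.comp β₀
  have hβ₁ (y) : β₁ y = U * β₀ y * star U := rfl
  refine ⟨N, α₀, β₁, J₀, ?_, hJ₀, fun y v v' h ↦ ?_⟩
  · ext1 d
    rw [StarAlgHom.comp_apply, StarAlgHom.comp_apply, hβ₁]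
    have h := hint d
    rw [StarAlgHom.comp_apply, StarAlgHom.comp_apply] at h
    rw [← h, mul_assoc, (Unitary.mem_iff.1 hU).2, mul_one]
  · rw [hβ₁, mul_apply_eq_comp, mul_apply_eq_comp, hUJ', hJ₁ y v v' h, hUJ]

theorem wordEval_apply_of_isometry {X Y H K : Type*} [NormedAddCommGroup H]
    [InnerProductSpace ℂ H] [NormedAddCommGroup K] [InnerProductSpace ℂ K]
    {σ : X → H →L[ℂ] H} {ρ : Y → H →L[ℂ] H} {σ₁ : X → K →L[ℂ] K} {ρ₁ : Y → K →L[ℂ] K}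
    {V : Submodule ℂ H} (J : V →ₗᵢ[ℂ] K)
    (hσ : ∀ x (v v' : V), (v' : H) = σ x v → σ₁ x (J v) = J v')
    (hρ : ∀ y (v v' : V), (v' : H) = ρ y v → ρ₁ y (J v) = J v')
    (ξ : V) (s : List (X ⊕ Y)) (hs : ∀ t, t <:+ s → wordEval σ ρ t ξ ∈ V) :
    wordEval σ₁ ρ₁ s (J ξ) = J ⟨wordEval σ ρ s ξ, hs s List.suffix_rfl⟩ := by
  induction s with
  | nil => simp [wordEval]
  | cons a s ih =>
    have h := ih fun t ht ↦ hs t (ht.trans (List.suffix_cons a s))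
    have hcons₁ : wordEval σ₁ ρ₁ (a :: s) = Sum.elim σ₁ ρ₁ a * wordEval σ₁ ρ₁ s := by
      simp [wordEval]
    have hcons : wordEval σ ρ (a :: s) = Sum.elim σ ρ a * wordEval σ ρ s := by
      simp [wordEval]
    rw [hcons₁, mul_apply_eq_comp, h]
    cases a with
    | inl x => exact hσ x _ _ (congrArg (fun T : H →L[ℂ] H ↦ T ξ) hcons)
    | inr y => exact hρ y _ _ (congrArg (fun T : H →L[ℂ] H ↦ T ξ) hcons)

theorem exists_ne_zero_norm_sub_mul_le {H : Type*} [NormedAddCommGroup H] [InnerProductSpace ℂ H]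
    [Nontrivial H] (T : H →L[ℂ] H) {ε : ℝ} (hε : 0 < ε) :
    ∃ ξ : H, ξ ≠ 0 ∧ (‖T‖ - ε) * ‖ξ‖ ≤ ‖T ξ‖ := by
  by_contra! hcon
  obtain ⟨η, hη⟩ := exists_ne (0 : H)
  have hpos : 0 ≤ ‖T‖ - ε := by
    by_contra! hneg
    have h1 := hcon η hη
    have h2 := mul_nonpos_of_nonpos_of_nonneg hneg.le (norm_nonneg η)
    linarith [norm_nonneg (T η)]
  have h := T.opNorm_le_bound hpos fun ξ ↦ by
    by_cases hξ : ξ = 0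
    · simp [hξ]
    · exact (hcon ξ hξ).le
  linarith

/-- The representation-theoretic content of Theorem 2.3 of the paper (residual finite
dimensionality of `M_n *_D M_{n'}` when the normalized traces agree on `D`): the norm of
any finite sum of words evaluated in representations coming from a compatible pair
`(α, β)` on a Hilbert space is approximated, up to any `ε > 0`, by its norm in
representations coming from a compatible pair `(α₁, β₁)` on a finite-dimensional Hilbert
space. -/
theorem stmt_3 (n n' : ℕ) (hn : 0 < n) (hn' : 0 < n')
    (D : Type*) [CStarAlgebra D] [FiniteDimensional ℂ D]
    (γ : D →⋆ₐ[ℂ] Matrix (Fin n) (Fin n) ℂ)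
    (γ' : D →⋆ₐ[ℂ] Matrix (Fin n') (Fin n') ℂ)
    (hγ : Function.Injective γ) (hγ' : Function.Injective γ')
    (htr : ∀ d : D, (γ d).trace / (n : ℂ) = (γ' d).trace / (n' : ℂ))
    (H : Type*) [NormedAddCommGroup H] [InnerProductSpace ℂ H] [CompleteSpace H]
    (α : Matrix (Fin n) (Fin n) ℂ →⋆ₐ[ℂ] (H →L[ℂ] H))
    (β : Matrix (Fin n') (Fin n') ℂ →⋆ₐ[ℂ] (H →L[ℂ] H))
    (hαβ : α.comp γ = β.comp γ')
    (M : ℕ) (w : Fin M → List (Matrix (Fin n) (Fin n) ℂ ⊕ Matrix (Fin n') (Fin n') ℂ))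
    (hw : ∀ i, w i ≠ [])
    (ε : ℝ) (hε : 0 < ε) :
    ∃ (d : ℕ)
      (α₁ : Matrix (Fin n) (Fin n) ℂ →⋆ₐ[ℂ]
        (EuclideanSpace ℂ (Fin d) →L[ℂ] EuclideanSpace ℂ (Fin d)))
      (β₁ : Matrix (Fin n') (Fin n') ℂ →⋆ₐ[ℂ]
        (EuclideanSpace ℂ (Fin d) →L[ℂ] EuclideanSpace ℂ (Fin d))),
      α₁.comp γ = β₁.comp γ' ∧
      ‖∑ i, wordEval (⇑α₁) (⇑β₁) (w i)‖ ≥ ‖∑ i, wordEval (⇑α) (⇑β) (w i)‖ - ε := by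
  rcases subsingleton_or_nontrivial H with hH | hH
  · let e : H ≃ₗᵢ[ℂ] EuclideanSpace ℂ (Fin (Module.finrank ℂ H)) :=
      (stdOrthonormalBasis ℂ H).repr
    refine ⟨_, e.conjStarAlgEquiv.toStarAlgHom.comp α, e.conjStarAlgEquiv.toStarAlgHom.comp β,
      ?_, ?_⟩
    · rw [StarAlgHom.comp_assoc, StarAlgHom.comp_assoc, hαβ]
    · have h : ‖∑ i, wordEval (⇑α) (⇑β) (w i)‖ = 0 := by
        rw [norm_eq_zero]
        ext1 x
        exact Subsingleton.elim _ _
      rw [h]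
      exact (sub_nonpos.2 hε.le).trans (norm_nonneg _)
  · set T := ∑ i, wordEval (⇑α) (⇑β) (w i) with hT
    obtain ⟨ξ, hξ, hle⟩ := exists_ne_zero_norm_sub_mul_le T hε
    let S : Set H := ⋃ i, (fun s ↦ wordEval (⇑α) (⇑β) s ξ) '' {s | s ∈ (w i).tails}
    have hS : S.Finite := Set.finite_iUnion fun i ↦ (List.finite_toSet _).image _
    have : FiniteDimensional ℂ (Submodule.span ℂ ({ξ} ∪ S)) :=
      .span_of_finite ℂ ((Set.finite_singleton ξ).union hS)
    obtain ⟨V, hVfin, hSV, hV⟩ :=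
      exists_invariant_submodule (α.comp γ) (Submodule.span ℂ ({ξ} ∪ S))
    have hsub : {ξ} ∪ S ⊆ V := Submodule.subset_span.trans hSV
    have hξV : ξ ∈ V := hsub (Or.inl rfl)
    have hwV (i : Fin M) (t) (ht : t <:+ w i) : wordEval (⇑α) (⇑β) t ξ ∈ V :=
      hsub (Or.inr (Set.mem_iUnion.2 ⟨i, t, (List.mem_tails t (w i)).2 ht, rfl⟩))
    have : Nontrivial V := ⟨⟨⟨ξ, hξV⟩, 0, fun h ↦ hξ (congrArg Subtype.val h)⟩⟩
    obtain ⟨N, α₁, β₁, J, hcomp, hα₁, hβ₁⟩ :=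
      exists_finiteDimensional_pair hn hn' γ γ' hγ htr α β hαβ V hV
    refine ⟨N, α₁, β₁, hcomp, ?_⟩
    set T₁ := ∑ i, wordEval (⇑α₁) (⇑β₁) (w i) with hT₁
    have hTξ : T ξ ∈ V := by
      rw [hT, sum_apply]
      exact V.sum_mem fun i _ ↦ hwV i _ List.suffix_rfl
    have h1 : T₁ (J ⟨ξ, hξV⟩) = J ⟨T ξ, hTξ⟩ := by
      rw [hT₁, sum_apply]
      simp only [wordEval_apply_of_isometry J hα₁ hβ₁ ⟨ξ, hξV⟩ _ (hwV _)]
      rw [← map_sum]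
      congr 1
      ext1
      simp [hT, sum_apply]
    have h2 : ‖T ξ‖ ≤ ‖T₁‖ * ‖ξ‖ := by
      have h3 := T₁.le_opNorm (J ⟨ξ, hξV⟩)
      rwa [h1, J.norm_map, J.norm_map] at h3
    exact le_of_mul_le_mul_right (hle.trans h2) (norm_pos_iff.2 hξ)
end

section
/- Let m, n, n' be positive integers and let γ : ℂ^m → M_n(ℂ) and γ' : ℂ^m → M_{n'}(ℂ) be unital *-homomorphisms from the abelian C*-algebra ℂ^m such that tr_n ∘ γ = tr_{n'} ∘ γ', where tr_k is the normalized trace on M_k(ℂ). Let H be an infinite-dimensional complex Hilbert space and let α : M_n(ℂ) → B(H) and β : M_{n'}(ℂ) → B(H) be unital *-homomorphisms with α ∘ γ = β ∘ γ'. Let F and G be finite-dimensional subspaces of H such that F is invariant under α(x) for every x ∈ M_n(ℂ) and G is invariant under β(y) for every y ∈ M_{n'}(ℂ). Then there exist a finite-dimensional subspace H₀ of H with F + G ⊆ H₀, and unital *-homomorphisms α̃ : M_n(ℂ) → B(H₀) and β̃ : M_{n'}(ℂ) → B(H₀), such that α̃ ∘ γ = β̃ ∘ γ', α̃(x)ξ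 = α(x)ξ for all x ∈ M_n(ℂ) and all ξ ∈ F, and β̃(y)η = β(y)η for all y ∈ M_{n'}(ℂ) and all η ∈ G. -/
open Module

/-- A tracial functional on a matrix algebra is a multiple of the trace. -/
theorem Matrix.card_mul_eq_trace_mul_of_tracial {ι : Type*} [Fintype ι] [DecidableEq ι]
    (t : Matrix ι ι ℂ →ₗ[ℂ] ℂ) (ht : ∀ a b, t (a * b) = t (b * a)) (x : Matrix ι ι ℂ) :
    (Fintype.card ι : ℂ) * t x = x.trace * t 1 := by
  have hdiag (i j : ι) : t (Matrix.single i i 1) = t (Matrix.single j j 1) := by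
    simpa using ht (Matrix.single i j 1) (Matrix.single j i 1)
  have hone (i : ι) : t 1 = Fintype.card ι * t (Matrix.single i i 1) := by
    rw [← Matrix.sum_single_one, map_sum, Finset.sum_congr rfl fun j _ => hdiag j i]
    simp
  suffices h : (Fintype.card ι : ℂ) • t = (Matrix.traceLinearMap ι ℂ ℂ).smulRight (t 1) by
    simpa using LinearMap.congr_fun h x
  refine Matrix.ext_linearMap ℂ fun i j => LinearMap.ext_ring ?_
  rcases eq_or_ne i j with rfl | hij
  · simpa using (hone i).symm
  · have := ht (Matrix.single i i 1) (Matrix.single i j 1)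
    simp [hij.symm] at this
    simp [this, hij]

section Representation

variable {n : ℕ} {V : Type*} [AddCommGroup V] [Module ℂ V]
  (π : Matrix (Fin n) (Fin n) ℂ →ₐ[ℂ] Module.End ℂ V)

theorem finrank_map_of_idempotent {S : Submodule ℂ V} [FiniteDimensional ℂ S]
    (hS : ∀ x, ∀ v ∈ S, π x v ∈ S) {p : Matrix (Fin n) (Fin n) ℂ} (hp : IsIdempotentElem p) :
    (n : ℂ) * finrank ℂ (S.map (π p)) = p.trace * finrank ℂ S := by
  let ρ : Matrix (Fin n) (Fin n) ℂ →ₗ[ℂ] Module.End ℂ S :=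
    { toFun := fun x => (π x).restrict (hS x)
      map_add' := fun x y => by ext; simp
      map_smul' := fun c x => by ext; simp }
  have hmul (x y) : ρ (x * y) = ρ x * ρ y :=
    LinearMap.ext fun v => Subtype.ext (DFunLike.congr_fun (map_mul π x y) (v : V))
  have hone : ρ 1 = 1 :=
    LinearMap.ext fun v => Subtype.ext (DFunLike.congr_fun (map_one π) (v : V))
  have hpp : IsIdempotentElem (ρ p) := by rw [IsIdempotentElem, ← hmul, hp.eq]
  have key := Matrix.card_mul_eq_trace_mul_of_tracial (LinearMap.trace ℂ S ∘ₗ ρ)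
    (fun a b => by
      rw [LinearMap.comp_apply, LinearMap.comp_apply, hmul, hmul, LinearMap.trace_mul_comm]) p
  have hrange : (LinearMap.range (ρ p)).map S.subtype = S.map (π p) := by
    ext v
    constructor
    · rintro ⟨_, ⟨s, rfl⟩, rfl⟩
      exact ⟨s, s.2, rfl⟩
    · rintro ⟨s, hs, rfl⟩
      exact ⟨_, ⟨⟨s, hs⟩, rfl⟩, rfl⟩
  have hfin : finrank ℂ (S.map (π p)) = finrank ℂ (LinearMap.range (ρ p)) := by
    rw [← hrange, Submodule.finrank_map_subtype_eq]
  have hproj := (LinearMap.IsIdempotentElem.isProj_range (ρ p) hpp).trace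
  rw [Fintype.card_fin, LinearMap.comp_apply, LinearMap.comp_apply, hone, LinearMap.trace_one,
    hproj] at key
  rw [hfin, key]

theorem dvd_finrank_of_invariant (hn : 0 < n) {S : Submodule ℂ V} [FiniteDimensional ℂ S]
    (hS : ∀ x, ∀ v ∈ S, π x v ∈ S) : n ∣ finrank ℂ S := by
  have h := finrank_map_of_idempotent π hS (p := Matrix.single ⟨0, hn⟩ ⟨0, hn⟩ 1)
    (by simp [IsIdempotentElem])
  rw [Matrix.trace_single_eq_same, one_mul] at h
  exact ⟨_, by exact_mod_cast h.symm⟩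

theorem exists_invariant_finrank_add (hn : 0 < n) (hV : ¬ FiniteDimensional ℂ V)
    {S : Submodule ℂ V} [FiniteDimensional ℂ S] (hS : ∀ x, ∀ v ∈ S, π x v ∈ S) :
    ∃ T : Submodule ℂ V, S ≤ T ∧ FiniteDimensional ℂ T ∧ (∀ x, ∀ v ∈ T, π x v ∈ T) ∧
      finrank ℂ T = finrank ℂ S + n := by
  obtain ⟨w, hw⟩ : ∃ w, w ∉ S := by
    by_contra! h
    have : S = ⊤ := by ext; simp [h]
    subst this
    exact hV (Module.Finite.equiv Submodule.topEquiv)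
  obtain ⟨i, hi⟩ : ∃ i, π (Matrix.single i i 1) w ∉ S := by
    by_contra! h
    apply hw
    have h1 : w = ∑ i, π (Matrix.single i i 1) w := by
      rw [← LinearMap.sum_apply, ← map_sum, Matrix.sum_single_one, map_one, Module.End.one_apply]
    rw [h1]
    exact S.sum_mem fun i _ => h i
  let f : (Fin n → ℂ) →ₗ[ℂ] V :=
    { toFun := fun c => π (Matrix.vecMulVec c (Pi.single i 1)) w
      map_add' := fun c d => by simp [Matrix.add_vecMulVec]
      map_smul' := fun r c => by simp [Matrix.smul_vecMulVec] }
  have hf (x c) : π x (f c) = f (x.mulVec c) := by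
    simp [f, ← Matrix.mul_vecMulVec]
  have hT : ∀ x, ∀ v ∈ S ⊔ LinearMap.range f, π x v ∈ S ⊔ LinearMap.range f := by
    intro x v hv
    obtain ⟨s, hs, _, ⟨c, rfl⟩, rfl⟩ := Submodule.mem_sup.1 hv
    rw [map_add, hf]
    exact Submodule.add_mem_sup (hS x s hs) ⟨_, rfl⟩
  refine ⟨S ⊔ LinearMap.range f, le_sup_left, inferInstance, hT, ?_⟩
  have hlt : finrank ℂ S < finrank ℂ (S ⊔ LinearMap.range f : Submodule ℂ V) := by
    refine Submodule.finrank_lt_finrank_of_lt (lt_of_le_of_ne le_sup_left fun h => hi ?_)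
    rw [h]
    refine Submodule.mem_sup_right ⟨Pi.single i 1, ?_⟩
    simp [f, Matrix.single_eq_single_vecMulVec_single]
  have hle : finrank ℂ (S ⊔ LinearMap.range f : Submodule ℂ V) ≤ finrank ℂ S + n :=
    (Submodule.finrank_add_le_finrank_add_finrank _ _).trans
      (Nat.add_le_add_left ((LinearMap.finrank_range_le f).trans (by simp)) _)
  obtain ⟨a, ha⟩ := dvd_finrank_of_invariant π hn hS
  obtain ⟨b, hb⟩ := dvd_finrank_of_invariant π hn hT
  rw [ha, hb] at hlt hle
  rw [ha, hb]
  have h1 : a < b := lt_of_mul_lt_mul_left hlt n.zero_le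
  have h2 : n * (a + 1) ≤ n * b := Nat.mul_le_mul_left n h1
  linarith [mul_add n a 1]

theorem exists_invariant_finrank_eq (hn : 0 < n) (hV : ¬ FiniteDimensional ℂ V)
    (E : Submodule ℂ V) [FiniteDimensional ℂ E] :
    ∃ k₀ : ℕ, ∀ k, k₀ ≤ k → ∃ T : Submodule ℂ V, E ≤ T ∧ FiniteDimensional ℂ T ∧
      (∀ x, ∀ v ∈ T, π x v ∈ T) ∧ finrank ℂ T = n * k := by
  let S := Submodule.map₂ π.toLinearMap ⊤ E
  have hSfin : FiniteDimensional ℂ S :=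
    Module.Finite.iff_fg.2 (Submodule.FG.map₂ _ Module.Finite.fg_top (Module.Finite.iff_fg.1 ‹_›))
  have hES : E ≤ S := fun v hv => by
    simpa using Submodule.apply_mem_map₂ π.toLinearMap (Submodule.mem_top (x := 1)) hv
  have hS : ∀ x, ∀ v ∈ S, π x v ∈ S := by
    intro x
    have h : S ≤ S.comap (π x) := Submodule.map₂_le.2 fun y _ v hv => by
      have := Submodule.apply_mem_map₂ π.toLinearMap (Submodule.mem_top (x := x * y)) hv
      rwa [AlgHom.toLinearMap_apply, map_mul] at this
    exact h
  obtain ⟨k₀, hk₀⟩ := dvd_finrank_of_invariant π hn hS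
  refine ⟨k₀, fun k hk => ?_⟩
  induction k, hk using Nat.le_induction with
  | base => exact ⟨S, hES, hSfin, hS, hk₀⟩
  | succ k _ ih =>
    obtain ⟨T, hET, hTfin, hT, hTk⟩ := ih
    obtain ⟨T', hTT', hT'fin, hT', hT'k⟩ := exists_invariant_finrank_add π hn hV hT
    exact ⟨T', hET.trans hTT', hT'fin, hT', by rw [hT'k, hTk, mul_add_one]⟩

end Representation

/-- Forgetting continuity, as an algebra homomorphism from continuous to linear endomorphisms. -/
def toModuleEndAlgHom (H : Type*) [NormedAddCommGroup H] [InnerProductSpace ℂ H] :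
    (H →L[ℂ] H) →ₐ[ℂ] Module.End ℂ H :=
  { ContinuousLinearMap.toLinearMapRingHom with commutes' := fun _ => rfl }

section Hilbert

variable {H : Type*} [NormedAddCommGroup H] [InnerProductSpace ℂ H]

theorem exists_linearIsometry_fixing {E E₁ E₂ : Submodule ℂ H}
    [FiniteDimensional ℂ E₁] [FiniteDimensional ℂ E₂] (h₂ : E ≤ E₂)
    (hd : finrank ℂ E₁ = finrank ℂ E₂) :
    ∃ V : E₁ →ₗᵢ[ℂ] H, (∀ x, V x ∈ E₂) ∧ ∀ x : E₁, (x : H) ∈ E → V x = x := by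
  let φ : E₁ ≃ₗᵢ[ℂ] E₂ := (stdOrthonormalBasis ℂ E₁).equiv
    (stdOrthonormalBasis ℂ E₂) (finCongr hd)
  let L : E.comap E₁.subtype →ₗᵢ[ℂ] E₁ :=
    { toLinearMap := φ.symm.toLinearEquiv.toLinearMap ∘ₗ
        (Submodule.inclusion h₂ ∘ₗ (E₁.subtype.restrict fun _ hx => hx))
      norm_map' := fun x => (φ.symm.norm_map _).trans rfl }
  refine ⟨E₂.subtypeₗᵢ.comp (φ.toLinearIsometry.comp L.extend), fun x => Subtype.coe_prop _,
    fun x hx => ?_⟩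
  have h : L.extend x = φ.symm ⟨x, h₂ hx⟩ := L.extend_apply ⟨x, hx⟩
  simp [h]

theorem exists_linearIsometry_intertwining [CompleteSpace H] {ι : Type*} [Fintype ι]
    {p : ι → H →L[ℂ] H} (hp : CompleteOrthogonalIdempotents p) (hsa : ∀ i, IsSelfAdjoint (p i))
    {E E₁ E₂ : Submodule ℂ H} [FiniteDimensional ℂ E₁] [FiniteDimensional ℂ E₂]
    (h₂ : E ≤ E₂)
    (hE₁ : ∀ i, ∀ x ∈ E₁, p i x ∈ E₁)
    (hE₂ : ∀ i, ∀ x ∈ E₂, p i x ∈ E₂)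
    (hd : ∀ i, finrank ℂ (E₁.map (p i).toLinearMap) = finrank ℂ (E₂.map (p i).toLinearMap)) :
    ∃ V : E₁ →ₗᵢ[ℂ] H, (∀ x, V x ∈ E₂) ∧ (∀ x : E₁, (x : H) ∈ E → V x = x) ∧
      ∀ i (x : E₁), V ⟨p i x, hE₁ i x x.2⟩ = p i (V x) := by
  have hsum' (x : H) : ∑ i, p i x = x := by
    rw [← sum_apply, hp.complete, one_apply_eq_self]
  have hidem (i) (x : H) : p i (p i x) = p i x := DFunLike.congr_fun (hp.idem i).eq x
  have hpp (i j) (hij : i ≠ j) (x : H) : p i (p j x) = 0 := DFunLike.congr_fun (hp.ortho hij) x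
  have horth (i j) (x y : H) (hij : i ≠ j) : inner ℂ (p i x) (p j y) = 0 := by
    rw [← ContinuousLinearMap.adjoint_inner_right, (hsa i).adjoint_eq, hpp i j hij,
      inner_zero_right]
  choose W hW hWE using fun i => exists_linearIsometry_fixing
    (Submodule.map_mono (f := (p i).toLinearMap) h₂) (hd i)
  let q (i : ι) : E₁ →ₗ[ℂ] E₁.map (p i).toLinearMap := (p i).toLinearMap.submoduleMap E₁
  have hpW (i) (x) : p i (W i x) = W i x := by
    obtain ⟨y, -, hy⟩ := hW i x
    rw [← hy]
    exact hidem i y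
  let V₀ : E₁ →ₗ[ℂ] H := ∑ i, (W i).toLinearMap ∘ₗ q i
  have hV₀ (x) : V₀ x = ∑ i, W i (q i x) := by simp [V₀]
  have hin (x y : E₁) : inner ℂ (V₀ x) (V₀ y) = inner ℂ x y := by
    have e1 : inner ℂ (V₀ x) (V₀ y) = ∑ i, inner ℂ (W i (q i x)) (W i (q i y)) := by
      rw [hV₀, hV₀, sum_inner]
      refine Finset.sum_congr rfl fun i _ => ?_
      rw [inner_sum]
      refine Finset.sum_eq_single i (fun j _ hij => ?_) (by simp)
      rw [← hpW i, ← hpW j, horth i j _ _ hij.symm]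
    have e2 : inner ℂ (x : H) (y : H) = ∑ i, inner ℂ (p i x) (p i y) := by
      conv_lhs => rw [← hsum' x, ← hsum' y]
      rw [sum_inner]
      refine Finset.sum_congr rfl fun i _ => ?_
      rw [inner_sum]
      exact Finset.sum_eq_single i (fun j _ hij => horth i j _ _ hij.symm) (by simp)
    rw [e1, Submodule.coe_inner, e2]
    refine Finset.sum_congr rfl fun i _ => ?_
    rw [(W i).inner_map_map]
    rfl
  refine ⟨V₀.isometryOfInner hin, fun x => ?_, fun x hx => ?_, fun i x => ?_⟩
  · rw [LinearMap.coe_isometryOfInner, hV₀]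
    refine E₂.sum_mem fun i _ => ?_
    obtain ⟨y, hy, hy'⟩ := hW i (q i x)
    rw [← hy']
    exact hE₂ i y hy
  · rw [LinearMap.coe_isometryOfInner, hV₀]
    conv_rhs => rw [← hsum' x]
    exact Finset.sum_congr rfl fun i _ => hWE i (q i x) ⟨x, hx, rfl⟩
  · rw [LinearMap.coe_isometryOfInner, hV₀, hV₀, map_sum]
    refine Finset.sum_congr rfl fun j _ => ?_
    rw [← hpW j (q j x)]
    rcases eq_or_ne i j with rfl | hij
    · rw [hidem, hpW]
      congr 1
      exact Subtype.ext (hidem i x)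
    · rw [hpp i j hij]
      have : q j ⟨p i x, hE₁ i x x.2⟩ = 0 := Subtype.ext (hpp j i hij.symm x)
      rw [this, map_zero]

/-- A representation restricts along an isometry whose range is invariant. -/
theorem exists_compression [CompleteSpace H] {A K : Type*} [Semiring A] [Algebra ℂ A] [Star A]
    [NormedAddCommGroup K] [InnerProductSpace ℂ K] [CompleteSpace K]
    (π : A →⋆ₐ[ℂ] (H →L[ℂ] H)) (V : K →ₗᵢ[ℂ] H)
    (hV : ∀ x k, ∃ k', V k' = π x (V k)) :
    ∃ ρ : A →⋆ₐ[ℂ] (K →L[ℂ] K), ∀ x k, V (ρ x k) = π x (V k) := by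
  let v := V.toContinuousLinearMap
  let ρ (x : A) : K →L[ℂ] K := v.adjoint ∘L π x ∘L v
  have hρ (x k) : V (ρ x k) = π x (V k) := by
    obtain ⟨k', hk'⟩ := hV x k
    have h : v.adjoint (v k') = k' := by
      refine ext_inner_right ℂ fun y => ?_
      rw [ContinuousLinearMap.adjoint_inner_left]
      exact V.inner_map_map k' y
    change V (v.adjoint (π x (V k))) = _
    rw [← hk']
    exact congrArg V h
  refine ⟨⟨⟨⟨⟨⟨ρ, ?_⟩, ?_⟩, ?_, ?_⟩, ?_⟩, ?_⟩, hρ⟩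
  · ext k; exact V.injective (by simp [hρ])
  · intro x y; ext k; exact V.injective (by simp [hρ])
  · ext k; exact V.injective (by simp [hρ])
  · intro x y; ext k; exact V.injective (by simp [hρ])
  · intro r; ext k; exact V.injective (by simp [hρ, Algebra.algebraMap_eq_smul_one])
  · intro x
    simp [ρ, ContinuousLinearMap.star_eq_adjoint, map_star, ContinuousLinearMap.adjoint_comp,
      ContinuousLinearMap.comp_assoc]

end Hilbert


/-- The key extension step in the proof of Theorem 2.3 of the paper: unital
*-representations `α` of `M_n(ℂ)` and `β` of `M_{n'}(ℂ)` on an infinite-dimensional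
Hilbert space `H` that agree on a common abelian subalgebra `ℂ^m` (with matching
normalized traces) can be simultaneously compressed to a common finite-dimensional
subspace `H₀ ⊇ F + G`, still agreeing on `ℂ^m`, without changing their action on the
prescribed invariant finite-dimensional subspaces `F` and `G`. -/
theorem stmt_4 (m n n' : ℕ) (hm : 0 < m) (hn : 0 < n) (hn' : 0 < n')
    (γ : (Fin m → ℂ) →⋆ₐ[ℂ] Matrix (Fin n) (Fin n) ℂ)
    (γ' : (Fin m → ℂ) →⋆ₐ[ℂ] Matrix (Fin n') (Fin n') ℂ)
    (htr : ∀ d : Fin m → ℂ, (γ d).trace / (n : ℂ) = (γ' d).trace / (n' : ℂ))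
    (H : Type*) [NormedAddCommGroup H] [InnerProductSpace ℂ H] [CompleteSpace H]
    (hinf : ¬ FiniteDimensional ℂ H)
    (α : Matrix (Fin n) (Fin n) ℂ →⋆ₐ[ℂ] (H →L[ℂ] H))
    (β : Matrix (Fin n') (Fin n') ℂ →⋆ₐ[ℂ] (H →L[ℂ] H))
    (hαβ : α.comp γ = β.comp γ')
    (F G : Submodule ℂ H) [FiniteDimensional ℂ F] [FiniteDimensional ℂ G]
    (hF : ∀ (x : Matrix (Fin n) (Fin n) ℂ) (ξ : H), ξ ∈ F → α x ξ ∈ F)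
    (hG : ∀ (y : Matrix (Fin n') (Fin n') ℂ) (η : H), η ∈ G → β y η ∈ G) :
    ∃ (H₀ : Submodule ℂ H) (_ : FiniteDimensional ℂ H₀), F ≤ H₀ ∧ G ≤ H₀ ∧
      ∃ (α₁ : Matrix (Fin n) (Fin n) ℂ →⋆ₐ[ℂ] (H₀ →L[ℂ] H₀))
        (β₁ : Matrix (Fin n') (Fin n') ℂ →⋆ₐ[ℂ] (H₀ →L[ℂ] H₀)),
        α₁.comp γ = β₁.comp γ' ∧
        (∀ (x : Matrix (Fin n) (Fin n) ℂ) (ξ : H₀), (ξ : H) ∈ F →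
          ((α₁ x ξ : H₀) : H) = α x (ξ : H)) ∧
        (∀ (y : Matrix (Fin n') (Fin n') ℂ) (η : H₀), (η : H) ∈ G →
          ((β₁ y η : H₀) : H) = β y (η : H)) := by
  let α' : Matrix (Fin n) (Fin n) ℂ →ₐ[ℂ] Module.End ℂ H :=
    (toModuleEndAlgHom H).comp α.toAlgHom
  let β' : Matrix (Fin n') (Fin n') ℂ →ₐ[ℂ] Module.End ℂ H :=
    (toModuleEndAlgHom H).comp β.toAlgHom
  obtain ⟨k, hk⟩ := exists_invariant_finrank_eq α' hn hinf (F ⊔ G)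
  obtain ⟨l, hl⟩ := exists_invariant_finrank_eq β' hn' hinf G
  obtain ⟨H₀, hFG, hfin, hH₀, hdim⟩ := hk (n' * (k + l)) (by nlinarith)
  obtain ⟨G₁, hGG₁, hfin₁, hG₁, hdim₁⟩ := hl (n * (k + l)) (by nlinarith)
  have hdd : finrank ℂ H₀ = finrank ℂ G₁ := by rw [hdim, hdim₁]; ring
  have hGH₀ : G ≤ H₀ := le_sup_right.trans hFG
  let e (i : Fin m) : Fin m → ℂ := Pi.single i 1
  have he : CompleteOrthogonalIdempotents e := CompleteOrthogonalIdempotents.single _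
  have hagree (d : Fin m → ℂ) : α (γ d) = β (γ' d) := DFunLike.congr_fun hαβ d
  let p (i : Fin m) : H →L[ℂ] H := α (γ (e i))
  have hp : CompleteOrthogonalIdempotents p := he.map (α.comp γ : (Fin m → ℂ) →+* (H →L[ℂ] H))
  have hesa (i : Fin m) : IsSelfAdjoint (e i) := by
    ext j
    rcases eq_or_ne j i with rfl | h <;> simp [e, *]
  have hsa (i : Fin m) : IsSelfAdjoint (p i) := ((hesa i).map γ).map α
  have hd (i : Fin m) : finrank ℂ (H₀.map (p i).toLinearMap) =
      finrank ℂ (G₁.map (p i).toLinearMap) := by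
    have h₀ : (n : ℂ) * finrank ℂ (H₀.map (p i).toLinearMap) = (γ (e i)).trace * finrank ℂ H₀ :=
      finrank_map_of_idempotent α' hH₀ ((he.idem i).map γ)
    have h₁ : (n' : ℂ) * finrank ℂ (G₁.map (β (γ' (e i))).toLinearMap) =
        (γ' (e i)).trace * finrank ℂ G₁ :=
      finrank_map_of_idempotent β' hG₁ ((he.idem i).map γ')
    rw [← hagree] at h₁
    have hn0 : (n : ℂ) ≠ 0 := by exact_mod_cast hn.ne'
    have hn0' : (n' : ℂ) ≠ 0 := by exact_mod_cast hn'.ne'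
    have ht := htr (e i)
    rw [← Nat.cast_inj (R := ℂ)]
    rw [div_eq_div_iff hn0 hn0'] at ht
    refine mul_left_cancel₀ (mul_ne_zero hn0 hn0') ?_
    rw [hdd] at h₀
    linear_combination (n' : ℂ) * h₀ - (n : ℂ) * h₁ + (finrank ℂ G₁ : ℂ) * ht
  obtain ⟨V, hVG₁, hVG, hVp⟩ := exists_linearIsometry_intertwining hp hsa hGG₁
    (fun i => hH₀ (γ (e i)))
    (fun i x hx => by simp only [p, hagree]; exact hG₁ (γ' (e i)) x hx) hd
  have hrange : LinearMap.range V.toLinearMap = G₁ := by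
    refine Submodule.eq_of_le_of_finrank_eq ?_ ?_
    · rintro _ ⟨x, rfl⟩
      exact hVG₁ x
    · rw [LinearMap.finrank_range_of_inj V.injective, hdd]
  obtain ⟨α₁, hα₁⟩ := exists_compression α H₀.subtypeₗᵢ fun x ξ => ⟨⟨_, hH₀ x ξ ξ.2⟩, rfl⟩
  obtain ⟨β₁, hβ₁⟩ := exists_compression β V fun y ξ => by
    have h : β y (V ξ) ∈ LinearMap.range V.toLinearMap := hrange ▸ hG₁ y _ (hVG₁ ξ)
    exact h
  have hbasis (i : Fin m) : α₁ (γ (e i)) = β₁ (γ' (e i)) := by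
    ext1 ξ
    apply V.injective
    rw [hβ₁, ← hagree]
    refine Eq.trans ?_ (hVp i ξ)
    exact congrArg V (Subtype.ext (hα₁ (γ (e i)) ξ))
  refine ⟨H₀, hfin, le_sup_left.trans hFG, hGH₀, α₁, β₁, ?_, fun x ξ _ => hα₁ x ξ,
    fun y η hη => ?_⟩
  · ext1 d
    have hde : d = ∑ i, d i • e i := by
      ext j
      simp [e, Pi.single_apply]
    change α₁ (γ d) = β₁ (γ' d)
    rw [hde]
    simp only [map_sum, map_smul, hbasis]
  · have h : β y η = V ⟨β y η, hGH₀ (hG y η hη)⟩ := 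
      (hVG ⟨β y η, hGH₀ (hG y η hη)⟩ (hG y η hη)).symm
    have h' := hβ₁ y η
    rw [hVG η hη, h] at h'
    exact congrArg Subtype.val (V.injective h')
end

section
/- Let m, n be positive integers and let γ : ℂ^m → M_n(ℂ) be a unital *-homomorphism. Let e_1, …, e_m denote the standard minimal projections of ℂ^m and let r_i be the rank of the projection matrix γ(e_i) (so r_1 + ⋯ + r_m = n). Let a' be a positive integer, let K be a complex Hilbert space of dimension n·a', and let R_1, …, R_m be orthogonal projections on K with R_1 + ⋯ + R_m = 1 and rank R_i = r_i·a' for each i. Then there exists a unital *-homomorphism α : M_n(ℂ) → B(K) such that α(γ(e_i)) = R_i for every i ∈ {1, …, m}. -/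
open Module

open scoped Kronecker InnerProductSpace

/-- The amplification `A ↦ A ⊗ 1` as a unital *-homomorphism between matrix algebras. -/
def Matrix.amplify (ι κ : Type*) [Fintype ι] [DecidableEq ι] [Fintype κ] [DecidableEq κ] :
    Matrix ι ι ℂ →⋆ₐ[ℂ] Matrix (ι × κ) (ι × κ) ℂ where
  toFun A := A ⊗ₖ (1 : Matrix κ κ ℂ)
  map_one' := Matrix.one_kronecker_one
  map_mul' A B := by simp [← Matrix.mul_kronecker_mul]
  map_zero' := Matrix.zero_kronecker _
  map_add' A B := Matrix.add_kronecker _ _ _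
  commutes' z := by
    simp [Algebra.algebraMap_eq_smul_one, Matrix.smul_kronecker]
  map_star' A := by
    simp [Matrix.star_eq_conjTranspose, Matrix.conjTranspose_kronecker]

section OrthonormalBasis

variable {ι κ E K : Type*} [Fintype ι] [DecidableEq ι] [Fintype κ] [DecidableEq κ]
  [NormedAddCommGroup E] [InnerProductSpace ℂ E] [FiniteDimensional ℂ E]
  [NormedAddCommGroup K] [InnerProductSpace ℂ K] [FiniteDimensional ℂ K]

/-- The *-isomorphism between operators and matrices given by an orthonormal basis. -/
noncomputable def OrthonormalBasis.matrixStarAlgEquiv (b : OrthonormalBasis ι ℂ E) :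
    Matrix ι ι ℂ ≃⋆ₐ[ℂ] (E →L[ℂ] E) :=
  Matrix.toEuclideanCLM.trans b.repr.symm.conjStarAlgEquiv

theorem OrthonormalBasis.matrixStarAlgEquiv_diagonal_apply (b : OrthonormalBasis ι ℂ E)
    (d : ι → ℂ) (j : ι) :
    b.matrixStarAlgEquiv (Matrix.diagonal d) (b j) = d j • b j := by
  apply b.repr.injective
  ext k
  by_cases h : k = j <;>
    simp [OrthonormalBasis.matrixStarAlgEquiv, Matrix.mulVec_diagonal, h]

theorem OrthonormalBasis.eq_matrixStarAlgEquiv_diagonal (b : OrthonormalBasis ι ℂ E)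
    {d : ι → ℂ} {T : E →L[ℂ] E} (h : ∀ j, T (b j) = d j • b j) :
    T = b.matrixStarAlgEquiv (Matrix.diagonal d) := by
  apply ContinuousLinearMap.coe_injective
  refine b.toBasis.ext fun j => ?_
  simpa [b.matrixStarAlgEquiv_diagonal_apply] using h j

/-- Orthonormal bases of `E` and of `K` indexed by `ι` and `ι × κ` induce a unital
*-homomorphism of operator algebras, which preserves diagonal operators. -/
theorem OrthonormalBasis.exists_starAlgHom_diagonal (b : OrthonormalBasis ι ℂ E)
    (c : OrthonormalBasis (ι × κ) ℂ K) :
    ∃ α : (E →L[ℂ] E) →⋆ₐ[ℂ] (K →L[ℂ] K), ∀ (T : E →L[ℂ] E) (S : K →L[ℂ] K) (d : ι → ℂ),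
      (∀ j, T (b j) = d j • b j) → (∀ p, S (c p) = d p.1 • c p) → α T = S := by
  refine ⟨(c.matrixStarAlgEquiv : _ →⋆ₐ[ℂ] _).comp ((Matrix.amplify ι κ).comp
    (b.matrixStarAlgEquiv.symm : _ →⋆ₐ[ℂ] _)), fun T S d hT hS => ?_⟩
  rw [b.eq_matrixStarAlgEquiv_diagonal hT,
    c.eq_matrixStarAlgEquiv_diagonal (d := fun p => d p.1) hS]
  have h : (Matrix.diagonal d) ⊗ₖ (1 : Matrix κ κ ℂ) = Matrix.diagonal fun p => d p.1 := by
    rw [← Matrix.diagonal_one, Matrix.diagonal_kronecker_diagonal]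
    simp
  simpa [Matrix.amplify] using h

end OrthonormalBasis

section ProjectionPartition

variable {ι E : Type*} [Fintype ι] [DecidableEq ι]
  [NormedAddCommGroup E] [InnerProductSpace ℂ E] [FiniteDimensional ℂ E]
  {T : ι → (E →L[ℂ] E)}

/-- Orthogonal projections summing to `1` are pairwise orthogonal. -/
theorem apply_apply_eq_zero_of_sum_eq_one (hsa : ∀ i, IsSelfAdjoint (T i))
    (hidem : ∀ i, T i * T i = T i) (hsum : ∑ i, T i = 1) {i j : ι} (hij : i ≠ j) (x : E) :
    T i (T j x) = 0 := by
  have hT (i : ι) (y : E) : T i (T i y) = T i y := congrArg (· y) (hidem i)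
  have hinner (i : ι) (y : E) : RCLike.re ⟪T i y, y⟫_ℂ = ‖T i y‖ ^ 2 := by
    have h : ⟪T i (T i y), y⟫_ℂ = ⟪T i y, T i y⟫_ℂ := (hsa i).isSymmetric (T i y) y
    rw [← inner_self_eq_norm_sq (𝕜 := ℂ), ← h, hT]
  have htotal : ∑ k, ‖T k (T j x)‖ ^ 2 = ‖T j x‖ ^ 2 := by
    have h : ∑ k, T k (T j x) = T j x := by
      simpa using congrArg (· (T j x)) hsum
    simp_rw [← hinner _ (T j x)]
    rw [← map_sum, ← sum_inner, h, inner_self_eq_norm_sq]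
  rw [← Finset.add_sum_erase _ _ (Finset.mem_univ j), hT, add_eq_left,
    Finset.sum_eq_zero_iff_of_nonneg fun _ _ => sq_nonneg _] at htotal
  simpa using htotal i (by simp [hij])

/-- A family of orthogonal projections summing to `1` is simultaneously diagonalized by an
orthonormal basis. -/
theorem exists_orthonormalBasis_of_sum_eq_one (hsa : ∀ i, IsSelfAdjoint (T i))
    (hidem : ∀ i, T i * T i = T i) (hsum : ∑ i, T i = 1) (r : ι → ℕ)
    (hr : ∀ i, finrank ℂ (LinearMap.range (T i : E →ₗ[ℂ] E)) = r i) :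
    ∃ b : OrthonormalBasis (Σ i, Fin (r i)) ℂ E,
      ∀ i j, T i (b j) = (if j.1 = i then (1 : ℂ) else 0) • b j := by
  let V (i : ι) : Submodule ℂ E := LinearMap.range (T i : E →ₗ[ℂ] E)
  have hV : OrthogonalFamily ℂ (fun i => V i) fun i => (V i).subtypeₗᵢ := by
    rintro i j hij ⟨_, x, rfl⟩ ⟨_, y, rfl⟩
    have h := (hsa i).isSymmetric x (T j y)
    simpa [apply_apply_eq_zero_of_sum_eq_one hsa hidem hsum hij] using h
  have hint : DirectSum.IsInternal V := by
    rw [hV.isInternal_iff, Submodule.orthogonal_eq_bot_iff, eq_top_iff]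
    intro x _
    have h : ∑ i, T i x = x := by simpa using congrArg (· x) hsum
    rw [← h]
    exact Submodule.sum_mem _ fun i _ => Submodule.mem_iSup_of_mem i ⟨x, rfl⟩
  let v (i : ι) : OrthonormalBasis (Fin (r i)) ℂ (V i) :=
    (stdOrthonormalBasis ℂ (V i)).reindex (finCongr (hr i))
  refine ⟨hint.collectedOrthonormalBasis hV v, fun i j => ?_⟩
  obtain ⟨x, hx⟩ := hint.collectedOrthonormalBasis_mem hV v j
  rw [← hx]
  split_ifs with h
  · subst h
    simpa using congrArg (· x) (hidem j.1)
  · simpa using apply_apply_eq_zero_of_sum_eq_one hsa hidem hsum (Ne.symm h) x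

end ProjectionPartition

/-- The representation-construction step in the proof of Theorem 2.3 of the paper: given a
unital *-homomorphism `γ : ℂ^m → M_n(ℂ)` with `r i = rank γ(e i)`, a Hilbert space `K` of
dimension `n * a'`, and orthogonal projections `R 1, …, R m` on `K` summing to `1` with
`rank (R i) = (r i) * a'`, there is a unital *-homomorphism `α : M_n(ℂ) → B(K)` with
`α (γ (e i)) = R i` for all `i`. -/
theorem stmt_5 (m n a' : ℕ) (hm : 0 < m) (hn : 0 < n) (ha' : 0 < a')
    (γ : (Fin m → ℂ) →⋆ₐ[ℂ] Matrix (Fin n) (Fin n) ℂ)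
    (K : Type*) [NormedAddCommGroup K] [InnerProductSpace ℂ K] [FiniteDimensional ℂ K]
    (hK : finrank ℂ K = n * a')
    (R : Fin m → (K →L[ℂ] K))
    (hRsa : ∀ i, IsSelfAdjoint (R i))
    (hRidem : ∀ i, R i * R i = R i)
    (hRsum : ∑ i, R i = 1)
    (hRrank : ∀ i, finrank ℂ (LinearMap.range ((R i : K →ₗ[ℂ] K))) =
      (γ (Pi.single i 1)).rank * a') :
    ∃ α : Matrix (Fin n) (Fin n) ℂ →⋆ₐ[ℂ] (K →L[ℂ] K),
      ∀ i, α (γ (Pi.single i 1)) = R i := by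
  let Φ := Matrix.toEuclideanCLM (n := Fin n) (𝕜 := ℂ)
  let P (i : Fin m) : EuclideanSpace ℂ (Fin n) →L[ℂ] EuclideanSpace ℂ (Fin n) :=
    Φ (γ (Pi.single i 1))
  have hPsa (i : Fin m) : IsSelfAdjoint (P i) := by
    have h : IsSelfAdjoint (Pi.single i 1 : Fin m → ℂ) := by
      simp [IsSelfAdjoint]
    exact (h.map γ).map Φ
  have hPidem (i : Fin m) : P i * P i = P i := by
    simp only [P, ← map_mul, ← Pi.single_mul, mul_one]
  have hPsum : ∑ i, P i = 1 := by
    simp only [P, ← map_sum]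
    rw [show ∑ i, (Pi.single i 1 : Fin m → ℂ) = 1 from Finset.univ_sum_single 1, map_one, map_one]
  have hPrank (i : Fin m) : finrank ℂ (LinearMap.range (P i).toLinearMap) =
      (γ (Pi.single i 1)).rank := by
    rw [Matrix.rank_eq_finrank_range_toLin _ (EuclideanSpace.basisFun (Fin n) ℂ).toBasis
      (EuclideanSpace.basisFun (Fin n) ℂ).toBasis, ← Matrix.toEuclideanLin_eq_toLin_orthonormal]
    rfl
  obtain ⟨b, hb⟩ := exists_orthonormalBasis_of_sum_eq_one hPsa hPidem hPsum _ hPrank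
  obtain ⟨c, hc⟩ := exists_orthonormalBasis_of_sum_eq_one hRsa hRidem hRsum _ hRrank
  let e : (Σ i, Fin ((γ (Pi.single i 1)).rank * a')) ≃
      (Σ i, Fin (γ (Pi.single i 1)).rank) × Fin a' :=
    (Equiv.sigmaCongrRight fun _ => finProdFinEquiv.symm).trans
      (Equiv.sigmaProdDistrib _ _).symm
  have he (p) : (e.symm p).1 = p.1.1 := rfl
  obtain ⟨α, hα⟩ := b.exists_starAlgHom_diagonal (c.reindex e)
  let Ψ : Matrix (Fin n) (Fin n) ℂ →⋆ₐ[ℂ]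
      (EuclideanSpace ℂ (Fin n) →L[ℂ] EuclideanSpace ℂ (Fin n)) := Φ
  refine ⟨α.comp Ψ, fun i => hα (P i) (R i) _ (hb i) fun p => ?_⟩
  rw [OrthonormalBasis.reindex_apply, hc, he]
end

section
/- Let k, ℓ : ℕ → ℕ be sequences with k(n) ≥ 2 and 1 ≤ ℓ(n) ≤ k(n) − 1 for all n, set α_n = ℓ(n)/k(n) ∈ (0,1), and assume that Σ_{n=1}^∞ α_n < ∞. Let λ = ∏_{n=1}^∞ (1 − α_n) (this infinite product converges to a positive real number), and for each finite subset F ⊆ ℕ define λ_F = λ / ∏_{n∈F} ( k(n)(1 − α_n) ) (with the empty product equal to 1). Then the family (λ_F²), indexed over all finite subsets F of ℕ, is summable, the infinite product ∏_{n=1}^∞ ( (1 − α_n)² + 1/k(n)² ) converges, and Σ_{F ⊆ ℕ, F finite} λ_F² = ∏_{n=1}^∞ ( (1 − α_n)² + 1/k(n)² ). -/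
open Filter in
/-- If `∑ a i` converges, `1 ≤ x i` and `1 / x i ≤ a i`, then `∑ 1 / (x i * (1 - a i)) ^ 2`
converges. -/
lemma summable_inv_sq_mul_one_sub {ι : Type*} {a x : ι → ℝ} (ha : Summable a)
    (hx : ∀ i, 1 ≤ x i) (hxa : ∀ i, 1 / x i ≤ a i) :
    Summable fun i => ((x i * (1 - a i)) ^ 2)⁻¹ := by
  refine (ha.mul_left 4).of_norm_bounded_eventually ?_
  filter_upwards [ha.tendsto_cofinite_zero.eventually_le_const one_half_pos] with i hi
  have hx0 : 0 < x i := one_pos.trans_le (hx i)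
  have hle : x i / 4 ≤ (x i * (1 - a i)) ^ 2 := by
    have h : x i / 2 ≤ x i * (1 - a i) := by nlinarith
    nlinarith [hx i]
  rw [Real.norm_of_nonneg (by positivity)]
  calc ((x i * (1 - a i)) ^ 2)⁻¹ ≤ (x i / 4)⁻¹ := inv_anti₀ (by positivity) hle
    _ = 4 * (1 / x i) := by field_simp
    _ ≤ 4 * a i := by gcongr; exact hxa i

/-- The product of `1 - a i` over a summable family with all `a i < 1` is positive. -/
lemma tprod_one_sub_pos_of_summable {ι : Type*} {a : ι → ℝ} (ha : Summable a)
    (ha1 : ∀ i, a i < 1) : 0 < ∏' i, (1 - a i) := by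
  have hlog : Summable fun i => Real.log (1 - a i) := by
    simpa only [sub_eq_add_neg] using Real.summable_log_one_add_of_summable ha.neg
  rw [← Real.rexp_tsum_eq_tprod (fun i => sub_pos.2 (ha1 i)) hlog]
  exact Real.exp_pos _


/-- The computation at the end of Section 3 of the paper: with `α n = ℓ n / k n ∈ (0,1)`,
`Σ α n < ∞`, `λ = ∏ (1 - α n)` and `λ_F = λ / ∏_{n ∈ F} (k n (1 - α n))` for finite
`F ⊆ ℕ`, the infinite product `∏ (1 - α n)` converges to a positive number, the family
`(λ_F²)_F` is summable, the product `∏ ((1 - α n)² + 1/(k n)²)` converges, and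
`Σ_F λ_F² = ∏ ((1 - α n)² + 1/(k n)²)`. -/
theorem stmt_7 (k ℓ : ℕ → ℕ) (hk : ∀ n, 2 ≤ k n)
    (hℓ1 : ∀ n, 1 ≤ ℓ n) (hℓ2 : ∀ n, ℓ n ≤ k n - 1)
    (hsum : Summable (fun n => (ℓ n : ℝ) / (k n : ℝ))) :
    Multipliable (fun n => 1 - (ℓ n : ℝ) / (k n : ℝ)) ∧
    0 < ∏' n, (1 - (ℓ n : ℝ) / (k n : ℝ)) ∧
    Summable (fun F : Finset ℕ =>
      ((∏' n, (1 - (ℓ n : ℝ) / (k n : ℝ))) /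
        ∏ n ∈ F, ((k n : ℝ) * (1 - (ℓ n : ℝ) / (k n : ℝ)))) ^ 2) ∧
    Multipliable (fun n => (1 - (ℓ n : ℝ) / (k n : ℝ)) ^ 2 + 1 / (k n : ℝ) ^ 2) ∧
    ∑' F : Finset ℕ,
        ((∏' n, (1 - (ℓ n : ℝ) / (k n : ℝ))) /
          ∏ n ∈ F, ((k n : ℝ) * (1 - (ℓ n : ℝ) / (k n : ℝ)))) ^ 2 =
      ∏' n, ((1 - (ℓ n : ℝ) / (k n : ℝ)) ^ 2 + 1 / (k n : ℝ) ^ 2) := by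
  have hk0 (n : ℕ) : (0 : ℝ) < k n := by exact_mod_cast two_pos.trans_le (hk n)
  have hα (n : ℕ) : (ℓ n : ℝ) / k n < 1 := by
    rw [div_lt_one (hk0 n)]
    have := hk n
    have := hℓ2 n
    exact_mod_cast (by omega : ℓ n < k n)
  have hβ : Multipliable fun n => 1 - (ℓ n : ℝ) / k n := by
    simpa only [sub_eq_add_neg] using Real.multipliable_one_add_of_summable hsum.neg
  have hg : Summable fun n => (((k n : ℝ) * (1 - (ℓ n : ℝ) / k n)) ^ 2)⁻¹ := by
    refine summable_inv_sq_mul_one_sub hsum (fun n => ?_) fun n => ?_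
    · exact_mod_cast one_le_two.trans (hk n)
    · have := hk0 n
      gcongr
      exact_mod_cast hℓ1 n
  have hgF := summable_finsetProd_of_summable_nonneg (fun n => by positivity) hg
  have hterm (F : Finset ℕ) :
      ((∏' n, (1 - (ℓ n : ℝ) / k n)) / ∏ n ∈ F, ((k n : ℝ) * (1 - (ℓ n : ℝ) / k n))) ^ 2 =
        (∏' n, (1 - (ℓ n : ℝ) / k n)) ^ 2 *
          ∏ n ∈ F, (((k n : ℝ) * (1 - (ℓ n : ℝ) / k n)) ^ 2)⁻¹ := by
    rw [div_pow, div_eq_mul_inv, Finset.prod_inv_distrib, Finset.prod_pow]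
  have hfactor (n : ℕ) : (1 - (ℓ n : ℝ) / k n) ^ 2 + 1 / (k n : ℝ) ^ 2 =
      (1 - (ℓ n : ℝ) / k n) ^ 2 * (1 + (((k n : ℝ) * (1 - (ℓ n : ℝ) / k n)) ^ 2)⁻¹) := by
    have h₁ := (hk0 n).ne'
    have h₂ := (sub_pos.2 (hα n)).ne'
    rw [mul_pow, mul_inv, mul_add, mul_one, mul_left_comm, mul_inv_cancel₀ (pow_ne_zero 2 h₂),
      mul_one, one_div]
  have hprod := (hβ.hasProd.pow 2).mul (hasProd_one_add_of_hasSum_prod hgF.hasSum)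
  simp only [hterm, hfactor]
  refine ⟨hβ, tprod_one_sub_pos_of_summable hsum hα, hgF.mul_left _, hprod.multipliable, ?_⟩
  rw [tsum_mul_left, hprod.tprod_eq]
end
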